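/- Let X = {x_1,…,x_n} and Y = {y_1,…,y_m} be disjoint sets of indeterminates, fix integers 1 ≤ j ≤ n, 1 ≤ k ≤ m, and 0 ≤ p ≤ binomial(n,j)·binomial(m,k). Then the p-th elementary symmetric polynomial e_p of the family of linear forms { ∑_{i ∈ S} x_i + ∑_{i ∈ T} y_i : S ⊆ [n], |S| = j, T ⊆ [m], |T| = k } is a nonnegative-integer linear combination of products s_λ(x_1,…,x_n)·s_μ(y_1,…,y_m) over pairs of partitions (λ, μ) with λ having at most n parts and μ having at most m parts. -/

import Mathlib

open MvPolynomial

/-- Complete homogeneous symmetric polynomial with integer index: `0` for negative index. -/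
noncomputable def hInt (n : ℕ) (m : ℤ) : MvPolynomial (Fin n) ℚ :=
  if 0 ≤ m then hsymm (Fin n) ℚ m.toNat else 0

/-- Schur polynomial via the Jacobi–Trudi determinant. -/
noncomputable def schur (n : ℕ) (lam : Fin n → ℕ) : MvPolynomial (Fin n) ℚ :=
  (Matrix.of fun i j : Fin n => hInt n ((lam i : ℤ) - (i : ℤ) + (j : ℤ))).det

/-- The Schur polynomial `s_λ(x_1,…,x_n)` in the `x`-alphabet of `ℚ[x_1,…,x_n,y_1,…,y_m]`. -/
noncomputable def schurX (n m : ℕ) (lam : Fin n → ℕ) : MvPolynomial (Fin n ⊕ Fin m) ℚ :=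
  rename Sum.inl (schur n lam)

/-- The Schur polynomial `s_μ(y_1,…,y_m)` in the `y`-alphabet of `ℚ[x_1,…,x_n,y_1,…,y_m]`. -/
noncomputable def schurY (n m : ℕ) (mu : Fin m → ℕ) : MvPolynomial (Fin n ⊕ Fin m) ℚ :=
  rename Sum.inr (schur m mu)

/-- The `p`-th elementary symmetric polynomial of the family of linear forms
`{ X_S + Y_T : S ⊆ [n], |S| = j, T ⊆ [m], |T| = k }`. -/
noncomputable def esymmTwoAlphabet (n m j k p : ℕ) : MvPolynomial (Fin n ⊕ Fin m) ℚ :=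
  ∑ F ∈ (((Finset.univ : Finset (Fin n)).powersetCard j) ×ˢ
          ((Finset.univ : Finset (Fin m)).powersetCard k)).powersetCard p,
    ∏ ST ∈ F, ((∑ i ∈ ST.1, X (Sum.inl i)) + ∑ i ∈ ST.2, X (Sum.inr i))

/-- The staircase exponent `(n-1, …, 1, 0; m-1, …, 1, 0)` of the two alphabets. -/
def stair (n m : ℕ) : Fin n ⊕ Fin m → ℕ :=
  Sum.elim (fun i => n - 1 - i) (fun i => m - 1 - i)

/-- The product `det (x_k ^ κ_i) * det (y_k ^ κ_i)` of two alternants, as a signed sum of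
monomials. -/
noncomputable def alternant {n m : ℕ} (κ : Fin n ⊕ Fin m → ℕ) :
    MvPolynomial (Fin n ⊕ Fin m) ℚ :=
  ∑ w : Equiv.Perm (Fin n) × Equiv.Perm (Fin m),
    monomial (Finsupp.equivFunOnFinite.symm (κ ∘ Equiv.sumCongr w.1 w.2))
      (((Equiv.Perm.sign w.1 : ℤ) : ℚ) * ((Equiv.Perm.sign w.2 : ℤ) : ℚ))

/-- The pairs of indices `i < j` in a common alphabet. -/
noncomputable def posPairs (n m : ℕ) : Finset ((Fin n ⊕ Fin m) × (Fin n ⊕ Fin m)) :=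
  (Finset.univ.filter fun q : Fin n × Fin n => q.1 < q.2).map
      (Function.Embedding.prodMap .inl .inl) ∪
    (Finset.univ.filter fun q : Fin m × Fin m => q.1 < q.2).map
      (Function.Embedding.prodMap .inr .inr)

lemma mem_posPairs {n m : ℕ} {q : (Fin n ⊕ Fin m) × (Fin n ⊕ Fin m)} :
    q ∈ posPairs n m ↔ q.1 < q.2 := by
  rcases q with ⟨i | i, j | j⟩ <;> simp [posPairs]

lemma monomial_equivFunOnFinite {ι : Type*} [Fintype ι] (κ : ι → ℕ) (r : ℚ) :
    monomial (Finsupp.equivFunOnFinite.symm κ) r = C r * ∏ i, X i ^ κ i := by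
  rw [monomial_eq, Finsupp.prod_fintype _ _ (by simp)]
  simp

lemma alternant_eq_det_mul_det {n m : ℕ} (κ : Fin n ⊕ Fin m → ℕ) :
    alternant κ =
      rename Sum.inl (Matrix.of fun i k : Fin n =>
        (X k : MvPolynomial (Fin n) ℚ) ^ κ (Sum.inl i)).det *
      rename Sum.inr (Matrix.of fun i k : Fin m =>
        (X k : MvPolynomial (Fin m) ℚ) ^ κ (Sum.inr i)).det := by
  rw [Matrix.det_apply', Matrix.det_apply', map_sum, map_sum, Finset.sum_mul_sum, alternant,
    Fintype.sum_prod_type]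
  refine Finset.sum_congr rfl fun σ _ => Finset.sum_congr rfl fun τ _ => ?_
  rw [monomial_equivFunOnFinite]
  simp [map_prod, Fintype.prod_sum_type]
  ring

lemma det_staircase {R : Type*} [CommRing R] {n : ℕ} (x : Fin n → R) :
    (Matrix.of fun i k : Fin n => x k ^ (n - 1 - (i : ℕ))).det =
      ∏ q ∈ Finset.univ.filter fun q : Fin n × Fin n => q.1 < q.2, (x q.1 - x q.2) := by
  have h : (Matrix.of fun i k : Fin n => x k ^ (n - 1 - (i : ℕ))).det =
      (Matrix.vandermonde fun i => x (Fin.rev i)).det := by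
    rw [← Matrix.det_transpose, ← Matrix.det_submatrix_equiv_self Fin.revPerm]
    congr 1
    ext i j
    simp [Matrix.vandermonde, Fin.val_rev]
    congr 1
    omega
  rw [h, Matrix.det_vandermonde, Finset.prod_sigma']
  refine Finset.prod_bij' (fun a _ => (Fin.rev a.2, Fin.rev a.1))
    (fun q _ => ⟨Fin.rev q.2, Fin.rev q.1⟩) ?_ ?_ ?_ ?_ ?_ <;> simp

lemma alternant_stair {n m : ℕ} :
    alternant (stair n m) = ∏ q ∈ posPairs n m, (X q.1 - X q.2) := by
  rw [alternant_eq_det_mul_det, posPairs, Finset.prod_union, Finset.prod_map, Finset.prod_map]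
  · simp [stair, det_staircase, map_prod]
  · rw [Finset.disjoint_left]
    rintro ⟨i | i, j | j⟩ <;> simp

lemma coeff_X_mul_pderiv {ι : Type*} (i : ι) (g : MvPolynomial ι ℚ) (ν : ι →₀ ℕ) :
    coeff ν (X i * pderiv i g) = ν i * coeff ν g := by
  classical
  induction g using MvPolynomial.induction_on' with
  | monomial u a =>
    rw [X_mul_pderiv_monomial, coeff_smul, coeff_monomial]
    split_ifs with h <;> simp [h]
  | add p q hp hq => simp [mul_add, hp, hq]

/-- The operator multiplying `x^ν` by `∑ i, ν_i ^ 2`. -/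
noncomputable def eulerSq {ι : Type*} [Fintype ι] (g : MvPolynomial ι ℚ) : MvPolynomial ι ℚ :=
  ∑ i, X i * pderiv i (X i * pderiv i g)

lemma coeff_eulerSq {ι : Type*} [Fintype ι] (g : MvPolynomial ι ℚ) (ν : ι →₀ ℕ) :
    coeff ν (eulerSq g) = (∑ i, (ν i : ℚ) ^ 2) * coeff ν g := by
  simp only [eulerSq, coeff_sum, coeff_X_mul_pderiv, Finset.sum_mul, sq, mul_assoc]

lemma eulerSq_mul {ι : Type*} [Fintype ι] (g h : MvPolynomial ι ℚ) :
    eulerSq (g * h) = eulerSq g * h + g * eulerSq h +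
      2 * ∑ i, (X i * pderiv i g) * (X i * pderiv i h) := by
  simp only [eulerSq, Finset.sum_mul, Finset.mul_sum, ← Finset.sum_add_distrib]
  refine Finset.sum_congr rfl fun i _ => ?_
  simp only [Derivation.leibniz, smul_eq_mul, pderiv_X_self, map_add]
  ring

lemma sum_sq_comp_sumCongr {n m : ℕ} (κ : Fin n ⊕ Fin m → ℕ)
    (w : Equiv.Perm (Fin n) × Equiv.Perm (Fin m)) :
    ∑ i, ((κ (Equiv.sumCongr w.1 w.2 i) : ℚ)) ^ 2 = ∑ i, (κ i : ℚ) ^ 2 :=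
  Equiv.sum_comp (Equiv.sumCongr w.1 w.2) fun i => (κ i : ℚ) ^ 2

lemma eulerSq_alternant {n m : ℕ} (κ : Fin n ⊕ Fin m → ℕ) :
    eulerSq (alternant κ) = C (∑ i, (κ i : ℚ) ^ 2) * alternant κ := by
  classical
  ext ν
  rw [coeff_eulerSq, coeff_C_mul, alternant, coeff_sum, Finset.mul_sum, Finset.mul_sum]
  refine Finset.sum_congr rfl fun w _ => ?_
  rw [coeff_monomial]
  split_ifs with h
  · rw [← h, ← sum_sq_comp_sumCongr κ w]
    rfl
  · simp

lemma X_mul_pderiv_alternant_stair {n m : ℕ} (k : Fin n ⊕ Fin m) :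
    X k * pderiv k (alternant (stair n m)) =
      ∑ q ∈ posPairs n m, (∏ r ∈ (posPairs n m).erase q, (X r.1 - X r.2)) *
        (X k * pderiv k (X q.1 - X q.2)) := by
  have key : ∀ s : Finset ((Fin n ⊕ Fin m) × (Fin n ⊕ Fin m)),
      X k * pderiv k (∏ q ∈ s, (X q.1 - X q.2 : MvPolynomial (Fin n ⊕ Fin m) ℚ)) =
      ∑ q ∈ s, (∏ r ∈ s.erase q, (X r.1 - X r.2)) * (X k * pderiv k (X q.1 - X q.2)) := by
    intro s
    induction s using Finset.induction_on with
    | empty => simp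
    | insert q s hq ih =>
      rw [Finset.prod_insert hq, Derivation.leibniz, Finset.sum_insert hq,
        Finset.erase_insert hq, smul_eq_mul, smul_eq_mul, mul_add, add_comm]
      congr 1
      · ring
      · rw [mul_left_comm, ih, Finset.mul_sum]
        refine Finset.sum_congr rfl fun r hr => ?_
        rw [Finset.erase_insert_of_ne (by rintro rfl; exact hq hr),
          Finset.prod_insert (by simp [hq])]
        ring
  rw [alternant_stair, key]

lemma sum_pderiv_alternant_mul {n m : ℕ} (g : MvPolynomial (Fin n ⊕ Fin m) ℚ) :
    ∑ i, (X i * pderiv i (alternant (stair n m))) * (X i * pderiv i g) =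
      ∑ q ∈ posPairs n m, (∏ r ∈ (posPairs n m).erase q, (X r.1 - X r.2)) *
        (X q.1 * (X q.1 * pderiv q.1 g) - X q.2 * (X q.2 * pderiv q.2 g)) := by
  classical
  simp only [X_mul_pderiv_alternant_stair, Finset.sum_mul]
  rw [Finset.sum_comm]
  refine Finset.sum_congr rfl fun q _ => ?_
  simp only [mul_assoc, ← Finset.mul_sum]
  congr 1
  simp [pderiv_X, Pi.single_apply, sub_mul, mul_sub, Finset.sum_sub_distrib]

lemma stair_strictAnti (n : ℕ) : StrictAnti fun i : Fin n => n - 1 - (i : ℕ) := by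
  intro i j h
  have : (i : ℕ) < j := h
  have := j.2
  simp only
  omega

lemma sum_mul_comp_perm_lt {n : ℕ} {κ δ : Fin n → ℕ} (hκ : StrictAnti κ) (hδ : StrictAnti δ)
    {σ : Equiv.Perm (Fin n)} (hσ : σ ≠ 1) :
    ∑ i, κ i * δ (σ i) < ∑ i, κ i * δ i := by
  have hmono : Monovary κ δ := fun i j h => (hκ.le_iff_ge).2 ((hδ.lt_iff_gt).1 h).le
  refine hmono.sum_mul_comp_perm_lt_sum_mul_iff.2 fun hm => hσ ?_
  have hs : StrictMono σ := by
    intro i j h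
    by_contra hc
    have h1 : σ j < σ i := lt_of_le_of_ne (not_lt.1 hc) fun e => h.ne' (σ.injective e)
    exact absurd (hm (hδ h1)) (not_le.2 (hκ h))
  ext i
  have := Subsingleton.elim (hs.orderIsoOfSurjective σ σ.surjective) (OrderIso.refl _)
  have h2 := congrArg (fun e : Fin n ≃o Fin n => e i) this
  exact congrArg Fin.val h2

lemma sum_mul_comp_perm_le {n : ℕ} {κ δ : Fin n → ℕ} (hκ : StrictAnti κ) (hδ : StrictAnti δ)
    (σ : Equiv.Perm (Fin n)) :
    ∑ i, κ i * δ (σ i) ≤ ∑ i, κ i * δ i := by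
  rcases eq_or_ne σ 1 with rfl | h
  · simp
  · exact (sum_mul_comp_perm_lt hκ hδ h).le

lemma sum_mul_stair_comp_lt {n m : ℕ} {κ : Fin n ⊕ Fin m → ℕ} (hκ : StrictAnti κ)
    {w : Equiv.Perm (Fin n) × Equiv.Perm (Fin m)} (hw : w ≠ 1) :
    ∑ i, κ i * stair n m (Equiv.sumCongr w.1 w.2 i) < ∑ i, κ i * stair n m i := by
  have h1 : StrictAnti (κ ∘ Sum.inl) := fun i j h => hκ (Sum.inl_lt_inl_iff.2 h)
  have h2 : StrictAnti (κ ∘ Sum.inr) := fun i j h => hκ (Sum.inr_lt_inr_iff.2 h)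
  simp only [Fintype.sum_sum_type, stair, Equiv.sumCongr_apply, Sum.map_inl, Sum.map_inr,
    Sum.elim_inl, Sum.elim_inr]
  by_cases h : w.1 = 1
  · have h' : w.2 ≠ 1 := fun h' => hw (Prod.ext h h')
    exact add_lt_add_of_le_of_lt (sum_mul_comp_perm_le h1 (stair_strictAnti n) w.1)
      (sum_mul_comp_perm_lt h2 (stair_strictAnti m) h')
  · exact add_lt_add_of_lt_of_le (sum_mul_comp_perm_lt h1 (stair_strictAnti n) h)
      (sum_mul_comp_perm_le h2 (stair_strictAnti m) w.2)

/-- The exponent of `x^ν` times the staircase monomial. -/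
noncomputable def addStair {n m : ℕ} (ν : Fin n ⊕ Fin m →₀ ℕ) : Fin n ⊕ Fin m →₀ ℕ :=
  ν + Finsupp.equivFunOnFinite.symm (stair n m)

lemma addStair_apply {n m : ℕ} (ν : Fin n ⊕ Fin m →₀ ℕ) (i : Fin n ⊕ Fin m) :
    addStair ν i = ν i + stair n m i := rfl

/-- The `(ν + δ)`-coefficient of `a_δ * g` is the `ν`-coefficient of `g` as soon as `g` has no
monomial above `ν` for the linear functional given by a strictly dominant weight. -/
lemma coeff_alternant_stair_mul {n m : ℕ} {κ : Fin n ⊕ Fin m → ℕ} (hκ : StrictAnti κ)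
    (g : MvPolynomial (Fin n ⊕ Fin m) ℚ) (ν : Fin n ⊕ Fin m →₀ ℕ)
    (h : ∀ μ ∈ g.support, ∑ i, κ i * μ i ≤ ∑ i, κ i * ν i) :
    coeff (addStair ν) (alternant (stair n m) * g) = coeff ν g := by
  rw [alternant, Finset.sum_mul, coeff_sum, Finset.sum_eq_single 1]
  · rw [coeff_monomial_mul']
    have h0 : (Finsupp.equivFunOnFinite.symm (stair n m ∘ Equiv.sumCongr
        (1 : Equiv.Perm (Fin n) × Equiv.Perm (Fin m)).1
        (1 : Equiv.Perm (Fin n) × Equiv.Perm (Fin m)).2)) =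
        Finsupp.equivFunOnFinite.symm (stair n m) := by
      ext i
      rcases i with i | i <;> simp
    rw [h0, addStair, if_pos (by simp)]
    simp
  · intro w _ hw
    rw [coeff_monomial_mul']
    split_ifs with hle
    · by_contra hne
      have hmem := mem_support_iff.2 (right_ne_zero_of_mul hne)
      have hadd := tsub_add_cancel_of_le hle
      have h1 := h _ hmem
      have h2 := sum_mul_stair_comp_lt hκ hw
      have h3 : ∑ i, κ i * (addStair ν - Finsupp.equivFunOnFinite.symm
          (stair n m ∘ Equiv.sumCongr w.1 w.2)) i +
          ∑ i, κ i * stair n m (Equiv.sumCongr w.1 w.2 i) =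
          ∑ i, κ i * ν i + ∑ i, κ i * stair n m i := by
        rw [← Finset.sum_add_distrib, ← Finset.sum_add_distrib]
        refine Finset.sum_congr rfl fun i _ => ?_
        rw [← mul_add, ← mul_add]
        congr 1
        exact DFunLike.congr_fun hadd i
      omega
    · rfl
  · simp

/-- Nonnegativity of a coefficient of `a_δ * g` when `g` has nonnegative coefficients and
`a_δ * g` is supported on a sphere. -/
lemma coeff_alternant_stair_mul_nonneg {n m : ℕ} (lam : Fin n ⊕ Fin m →₀ ℕ)
    (hlam : StrictAnti (addStair lam)) (g : MvPolynomial (Fin n ⊕ Fin m) ℚ)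
    (hg : ∀ ν, 0 ≤ coeff ν g)
    (hs : ∀ ν : Fin n ⊕ Fin m →₀ ℕ,
      coeff (addStair ν) (alternant (stair n m) * g) ≠ 0 →
      ∑ i, (addStair ν i : ℚ) ^ 2 = ∑ i, (addStair lam i : ℚ) ^ 2) :
    0 ≤ coeff (addStair lam) (alternant (stair n m) * g) := by
  by_cases hmax : ∀ μ ∈ g.support, ∑ i, addStair lam i * μ i ≤ ∑ i, addStair lam i * lam i
  · rw [coeff_alternant_stair_mul hlam g lam hmax]
    exact hg lam
  push Not at hmax
  obtain ⟨μ, hμ, hlt⟩ := hmax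
  obtain ⟨ν, hν, hνmax⟩ := g.support.exists_max_image
    (fun μ => ∑ i, addStair lam i * μ i) ⟨μ, hμ⟩
  have h1 := coeff_alternant_stair_mul hlam g ν hνmax
  have h2 := hs ν (by rw [h1]; exact mem_support_iff.1 hν)
  exfalso
  have h3 : ∑ i, addStair lam i * lam i < ∑ i, addStair lam i * ν i := hlt.trans_le (hνmax μ hμ)
  have h4 : ∑ i, (addStair lam i : ℚ) * lam i < ∑ i, (addStair lam i : ℚ) * ν i := by
    exact_mod_cast h3
  have h5 : ∑ i, (addStair ν i : ℚ) ^ 2 = ∑ i, (addStair lam i : ℚ) ^ 2 +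
      2 * (∑ i, (addStair lam i : ℚ) * ν i - ∑ i, (addStair lam i : ℚ) * lam i) +
      ∑ i, ((ν i : ℚ) - lam i) ^ 2 := by
    rw [← Finset.sum_sub_distrib, Finset.mul_sum, ← Finset.sum_add_distrib,
      ← Finset.sum_add_distrib]
    refine Finset.sum_congr rfl fun i _ => ?_
    simp only [addStair_apply, Nat.cast_add]
    ring
  have h6 : 0 ≤ ∑ i, ((ν i : ℚ) - lam i) ^ 2 := Finset.sum_nonneg fun i _ => sq_nonneg _
  linarith

section Casimir

variable {α A : Type*} [Fintype α] [LinearOrder α] [Ring A]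

lemma sum_lt_add_sum_gt_add_sum_diag (F : α → α → A) :
    ∑ q ∈ Finset.univ.filter (fun q : α × α => q.1 < q.2), (F q.1 q.2 + F q.2 q.1) +
      ∑ i, F i i = ∑ i, ∑ j, F i j := by
  have h1 : ∑ q ∈ Finset.univ.filter (fun q : α × α => q.1 < q.2), F q.2 q.1 =
      ∑ q ∈ Finset.univ.filter (fun q : α × α => q.2 < q.1), F q.1 q.2 :=
    Finset.sum_bij' (fun q _ => q.swap) (fun q _ => q.swap) (by simp) (by simp) (by simp)
      (by simp) (by simp)
  have h2 : ∑ i, F i i = ∑ q ∈ Finset.univ.filter (fun q : α × α => q.1 = q.2), F q.1 q.2 :=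
    Finset.sum_bij' (fun i _ => (i, i)) (fun q _ => q.1) (by simp) (by simp) (by simp)
      (by simp +contextual [Prod.ext_iff]) (by simp)
  rw [Finset.sum_add_distrib, h1, h2, ← Fintype.sum_prod_type', Finset.sum_filter,
    Finset.sum_filter, Finset.sum_filter, ← Finset.sum_add_distrib, ← Finset.sum_add_distrib]
  refine Finset.sum_congr rfl fun q _ => ?_
  rcases lt_trichotomy q.1 q.2 with h | h | h
  · simp [h, h.not_gt, h.ne]
  · simp [h]
  · simp [h, h.not_gt, h.ne']

/-- The quadratic Casimir element of `gl_α`, shifted by a multiple of the central element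
`∑ i, e i i`, commutes with `gl_α`. -/
lemma commute_casimir (e : α → α → A)
    (he : ∀ i j k l, e i j * e k l - e k l * e i j =
      (if j = k then e i l else 0) - (if l = i then e k j else 0)) (k l : α) :
    Commute (∑ i, e i i * e i i + 2 * ∑ q ∈ Finset.univ.filter (fun q : α × α => q.1 < q.2),
      (e q.2 q.1 * e q.1 q.2 + e q.1 q.1)) (e k l) := by
  have h1 : ∑ i, e i i * e i i + 2 * ∑ q ∈ Finset.univ.filter (fun q : α × α => q.1 < q.2),
      (e q.2 q.1 * e q.1 q.2 + e q.1 q.1) =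
      ∑ i, ∑ j, e i j * e j i + (Fintype.card α : A) * ∑ i, e i i - ∑ i, e i i := by
    have h := sum_lt_add_sum_gt_add_sum_diag fun i j => e i j * e j i + e i i
    simp only [Finset.sum_add_distrib, Finset.sum_const, Finset.card_univ, nsmul_eq_mul,
      ← Finset.mul_sum] at h
    rw [← h, two_mul]
    have h2 : ∑ q ∈ Finset.univ.filter (fun q : α × α => q.1 < q.2), e q.1 q.2 * e q.2 q.1 =
        ∑ q ∈ Finset.univ.filter (fun q : α × α => q.1 < q.2),
          (e q.2 q.1 * e q.1 q.2 + e q.1 q.1 - e q.2 q.2) := by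
      refine Finset.sum_congr rfl fun q hq => ?_
      have := he q.1 q.2 q.2 q.1
      simp only [if_true] at this
      rw [add_sub_assoc, ← this]
      abel
    rw [h2]
    simp only [Finset.sum_add_distrib, Finset.sum_sub_distrib]
    abel
  have hc : Commute (∑ i, e i i) (e k l) := by
    rw [commute_iff_eq, ← sub_eq_zero, Finset.sum_mul, Finset.mul_sum, ← Finset.sum_sub_distrib]
    simp [he]
  have hq : Commute (∑ i, ∑ j, e i j * e j i) (e k l) := by
    rw [commute_iff_eq, ← sub_eq_zero, Finset.sum_mul, Finset.mul_sum, ← Finset.sum_sub_distrib]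
    have : ∀ i j, e i j * e j i * e k l - e k l * (e i j * e j i) =
        (if i = k then e k j * e j l else 0) - (if l = j then e i l * e k i else 0) +
        ((if j = k then e i l * e k i else 0) - (if l = i then e k j * e j l else 0)) := by
      intro i j
      have : e i j * e j i * e k l - e k l * (e i j * e j i) =
          e i j * (e j i * e k l - e k l * e j i) + (e i j * e k l - e k l * e i j) * e j i := by
        noncomm_ring
      rw [this, he, he]
      split_ifs <;> subst_vars <;> simp [mul_sub, sub_mul]
    simp only [Finset.sum_mul, Finset.mul_sum, ← Finset.sum_sub_distrib, this,
      Finset.sum_add_distrib]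
    simp only [Finset.sum_sub_distrib]
    rw [Finset.sum_comm (f := fun i j => if i = k then e k j * e j l else 0),
      Finset.sum_comm (f := fun i j => if l = i then e k j * e j l else 0)]
    simp
  rw [h1]
  exact (hq.add_left ((Nat.cast_commute _ _).mul_left hc)).sub_left hc

end Casimir

/-- A polynomial representation of `gl_I` by rational matrices, with a basis of weight vectors
that is orthonormal for an invariant form. -/
structure WeightModule (I B : Type*) [DecidableEq I] [Fintype B] [DecidableEq B] where
  /-- The weight of a basis vector. -/
  wt : B → I →₀ ℕ
  /-- The action of the matrix unit `E i j`. -/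
  E : I → I → Matrix B B ℚ
  comm : ∀ i j k l, E i j * E k l - E k l * E i j =
    (if j = k then E i l else 0) - (if l = i then E k j else 0)
  transpose_E : ∀ i j, (E i j).transpose = E j i
  E_diag : ∀ i, E i i = Matrix.diagonal fun b => (wt b i : ℚ)
  weight_E : ∀ i j b b', E i j b b' ≠ 0 →
    wt b + Finsupp.single j 1 = wt b' + Finsupp.single i 1

namespace WeightModule

variable {n m : ℕ} {B : Type*} [Fintype B] [DecidableEq B]
  (U : WeightModule (Fin n ⊕ Fin m) B)

/-- The trace of a matrix, refined by the weights. -/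
noncomputable def wtrace (S : Matrix B B ℚ) : MvPolynomial (Fin n ⊕ Fin m) ℚ :=
  ∑ b, monomial (U.wt b) (S b b)

lemma wtrace_add (S S' : Matrix B B ℚ) : U.wtrace (S + S') = U.wtrace S + U.wtrace S' := by
  simp [wtrace, Finset.sum_add_distrib]

lemma wtrace_smul (r : ℚ) (S : Matrix B B ℚ) : U.wtrace (r • S) = C r * U.wtrace S := by
  simp [wtrace, Finset.mul_sum, C_mul_monomial]

lemma wtrace_sum {ι : Type*} (s : Finset ι) (S : ι → Matrix B B ℚ) :
    U.wtrace (∑ a ∈ s, S a) = ∑ a ∈ s, U.wtrace (S a) := by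
  simp only [wtrace, Matrix.sum_apply, map_sum]
  exact Finset.sum_comm

lemma wtrace_mul_E_diag (S : Matrix B B ℚ) (i : Fin n ⊕ Fin m) :
    U.wtrace (S * U.E i i) = X i * pderiv i (U.wtrace S) := by
  simp only [wtrace, map_sum, Finset.mul_sum, X_mul_pderiv_monomial, U.E_diag,
    Matrix.mul_diagonal]
  refine Finset.sum_congr rfl fun b _ => ?_
  rw [smul_monomial, nsmul_eq_mul, mul_comm]

lemma X_mul_wtrace_mul_E (N : Matrix B B ℚ) (i j : Fin n ⊕ Fin m) :
    X i * U.wtrace (N * U.E i j) = X j * U.wtrace (U.E i j * N) := by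
  simp only [wtrace, Matrix.mul_apply, map_sum, Finset.mul_sum]
  rw [Finset.sum_comm]
  refine Finset.sum_congr rfl fun b _ => Finset.sum_congr rfl fun b' _ => ?_
  by_cases h : U.E i j b b' = 0
  · simp [h]
  · have := U.weight_E i j b b' h
    simp only [X, monomial_mul, one_mul]
    rw [add_comm _ (U.wt b'), add_comm _ (U.wt b), this, mul_comm]

/-- The shifted Casimir element of `gl_n × gl_m`. -/
noncomputable def casimir : Matrix B B ℚ :=
  ∑ i, U.E i i * U.E i i +
    2 * ∑ q ∈ posPairs n m, (U.E q.2 q.1 * U.E q.1 q.2 + U.E q.1 q.1)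

lemma transpose_casimir : U.casimir.transpose = U.casimir := by
  have h2 : (2 : Matrix B B ℚ).transpose = 2 := Matrix.transpose_ofNat 2
  simp only [casimir, Matrix.transpose_add, Matrix.transpose_mul, Matrix.transpose_sum,
    U.transpose_E, h2]
  congr 1
  rw [two_mul, mul_two]

lemma commute_E_of_ne {i j k l : Fin n ⊕ Fin m} (hjk : j ≠ k) (hli : l ≠ i) :
    Commute (U.E i j) (U.E k l) := by
  rw [commute_iff_eq, ← sub_eq_zero, U.comm, if_neg hjk, if_neg hli, sub_zero]

lemma casimir_eq_add : U.casimir =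
    (∑ i, U.E (.inl i) (.inl i) * U.E (.inl i) (.inl i) +
      2 * ∑ q ∈ Finset.univ.filter (fun q : Fin n × Fin n => q.1 < q.2),
      (U.E (.inl q.2) (.inl q.1) * U.E (.inl q.1) (.inl q.2) + U.E (.inl q.1) (.inl q.1))) +
    (∑ i, U.E (.inr i) (.inr i) * U.E (.inr i) (.inr i) +
      2 * ∑ q ∈ Finset.univ.filter (fun q : Fin m × Fin m => q.1 < q.2),
      (U.E (.inr q.2) (.inr q.1) * U.E (.inr q.1) (.inr q.2) + U.E (.inr q.1) (.inr q.1))) := by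
  rw [casimir, Fintype.sum_sum_type, posPairs, Finset.sum_union, Finset.sum_map, Finset.sum_map]
  · simp only [Function.Embedding.coe_prodMap, Prod.map_fst, Prod.map_snd,
      Function.Embedding.inl_apply, Function.Embedding.inr_apply]
    rw [mul_add]
    abel
  · rw [Finset.disjoint_left]
    rintro ⟨i | i, j | j⟩ <;> simp

/-- The matrix commutes with the action of `gl_n × gl_m`. -/
def IsInvariant (S : Matrix B B ℚ) : Prop :=
  (∀ i j : Fin n, Commute S (U.E (.inl i) (.inl j))) ∧
    ∀ i j : Fin m, Commute S (U.E (.inr i) (.inr j))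

variable {U} in
lemma IsInvariant.commute_of_lt {S : Matrix B B ℚ} (hS : U.IsInvariant S)
    {i j : Fin n ⊕ Fin m} (h : i < j) : Commute S (U.E i j) ∧ Commute S (U.E j i) := by
  rcases i with i | i <;> rcases j with j | j
  · exact ⟨hS.1 _ _, hS.1 _ _⟩
  · exact absurd h Sum.not_inl_lt_inr
  · exact absurd h Sum.not_inr_lt_inl
  · exact ⟨hS.2 _ _, hS.2 _ _⟩

lemma isInvariant_casimir : U.IsInvariant U.casimir := by
  constructor
  · intro k l
    rw [casimir_eq_add]
    refine Commute.add_left ?_ ?_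
    · exact commute_casimir (fun i j => U.E (.inl i) (.inl j))
        (fun i j k l => by simp [U.comm]) k l
    · have h : ∀ i j : Fin m, Commute (U.E (.inr i) (.inr j)) (U.E (.inl k) (.inl l)) :=
        fun i j => U.commute_E_of_ne (by simp) (by simp)
      refine Commute.add_left (Commute.sum_left _ _ _ fun i _ => (h i i).mul_left (h i i)) ?_
      exact (Commute.ofNat_left 2 _).mul_left (Commute.sum_left _ _ _ fun q _ =>
        ((h _ _).mul_left (h _ _)).add_left (h _ _))
  · intro k l
    rw [casimir_eq_add]
    refine Commute.add_left ?_ ?_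
    · have h : ∀ i j : Fin n, Commute (U.E (.inl i) (.inl j)) (U.E (.inr k) (.inr l)) :=
        fun i j => U.commute_E_of_ne (by simp) (by simp)
      refine Commute.add_left (Commute.sum_left _ _ _ fun i _ => (h i i).mul_left (h i i)) ?_
      exact (Commute.ofNat_left 2 _).mul_left (Commute.sum_left _ _ _ fun q _ =>
        ((h _ _).mul_left (h _ _)).add_left (h _ _))
    · exact commute_casimir (fun i j => U.E (.inr i) (.inr j))
        (fun i j k l => by simp [U.comm]) k l

variable {U}

lemma IsInvariant.mul {S S' : Matrix B B ℚ} (hS : U.IsInvariant S) (hS' : U.IsInvariant S') :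
    U.IsInvariant (S * S') :=
  ⟨fun i j => (hS.1 i j).mul_left (hS'.1 i j), fun i j => (hS.2 i j).mul_left (hS'.2 i j)⟩

lemma IsInvariant.commute_casimir {S : Matrix B B ℚ} (hS : U.IsInvariant S) :
    Commute S U.casimir := by
  rw [casimir_eq_add]
  refine Commute.add_right ?_ ?_
  · refine Commute.add_right (Commute.sum_right _ _ _ fun i _ =>
      (hS.1 i i).mul_right (hS.1 i i)) ?_
    exact (Commute.ofNat_right _ 2).mul_right (Commute.sum_right _ _ _ fun q _ =>
      ((hS.1 _ _).mul_right (hS.1 _ _)).add_right (hS.1 _ _))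
  · refine Commute.add_right (Commute.sum_right _ _ _ fun i _ =>
      (hS.2 i i).mul_right (hS.2 i i)) ?_
    exact (Commute.ofNat_right _ 2).mul_right (Commute.sum_right _ _ _ fun q _ =>
      ((hS.2 _ _).mul_right (hS.2 _ _)).add_right (hS.2 _ _))

lemma IsInvariant.sub_mul_wtrace {S : Matrix B B ℚ} (hS : U.IsInvariant S)
    {i j : Fin n ⊕ Fin m} (h : i < j) :
    (X i - X j) * U.wtrace (S * (U.E j i * U.E i j)) =
      X j * (X i * pderiv i (U.wtrace S) - X j * pderiv j (U.wtrace S)) := by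
  have h1 := U.X_mul_wtrace_mul_E (S * U.E j i) i j
  have h2 : U.E i j * (S * U.E j i) =
      S * (U.E j i * U.E i j) + S * U.E i i + (-1 : ℚ) • (S * U.E j j) := by
    have hc := U.comm i j j i
    simp only [if_true] at hc
    rw [← mul_assoc, ← (hS.commute_of_lt h).1.eq, mul_assoc, neg_one_smul, ← sub_eq_add_neg,
      add_sub_assoc, ← mul_sub, ← mul_add, ← hc]
    congr 1
    abel
  rw [h2, wtrace_add, wtrace_add, wtrace_smul, wtrace_mul_E_diag, wtrace_mul_E_diag,
    mul_assoc] at h1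
  rw [sub_mul, h1]
  simp
  ring

/-- The radial part of the Casimir element. -/
lemma IsInvariant.alternant_mul_wtrace_casimir {S : Matrix B B ℚ} (hS : U.IsInvariant S) :
    alternant (stair n m) * U.wtrace (S * U.casimir) =
      eulerSq (alternant (stair n m) * U.wtrace S) -
        C (∑ i, (stair n m i : ℚ) ^ 2) * (alternant (stair n m) * U.wtrace S) := by
  have h1 : U.wtrace (S * U.casimir) = eulerSq (U.wtrace S) +
      2 * ∑ q ∈ posPairs n m, (U.wtrace (S * (U.E q.2 q.1 * U.E q.1 q.2)) +
        X q.1 * pderiv q.1 (U.wtrace S)) := by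
    rw [casimir, mul_add, wtrace_add, Finset.mul_sum, wtrace_sum, eulerSq]
    congr 1
    · refine Finset.sum_congr rfl fun i _ => ?_
      rw [← mul_assoc, wtrace_mul_E_diag, wtrace_mul_E_diag]
    · rw [two_mul, mul_add, wtrace_add, Finset.mul_sum, wtrace_sum, two_mul]
      simp only [mul_add, wtrace_add, wtrace_mul_E_diag]
  rw [eulerSq_mul, eulerSq_alternant, sum_pderiv_alternant_mul, h1]
  have h2 : alternant (stair n m) * ∑ q ∈ posPairs n m,
      (U.wtrace (S * (U.E q.2 q.1 * U.E q.1 q.2)) + X q.1 * pderiv q.1 (U.wtrace S)) =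
      ∑ q ∈ posPairs n m, (∏ r ∈ (posPairs n m).erase q, (X r.1 - X r.2)) *
        (X q.1 * (X q.1 * pderiv q.1 (U.wtrace S)) -
          X q.2 * (X q.2 * pderiv q.2 (U.wtrace S))) := by
    rw [Finset.mul_sum]
    refine Finset.sum_congr rfl fun q hq => ?_
    rw [alternant_stair, ← Finset.prod_erase_mul _ _ hq, mul_assoc, mul_add,
      hS.sub_mul_wtrace (mem_posPairs.1 hq)]
    ring
  rw [← h2]
  ring

lemma IsInvariant.coeff_alternant_mul_wtrace_casimir {S : Matrix B B ℚ} (hS : U.IsInvariant S)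
    (κ : Fin n ⊕ Fin m →₀ ℕ) :
    coeff κ (alternant (stair n m) * U.wtrace (S * U.casimir)) =
      (∑ i, (κ i : ℚ) ^ 2 - ∑ i, (stair n m i : ℚ) ^ 2) *
        coeff κ (alternant (stair n m) * U.wtrace S) := by
  rw [hS.alternant_mul_wtrace_casimir, coeff_sub, coeff_eulerSq, coeff_C_mul, sub_mul]

end WeightModule

lemma Matrix.mul_eq_zero_of_pow_mul_eq_zero {B : Type*} [Fintype B] [DecidableEq B]
    {A N : Matrix B B ℚ} (hA : A.transpose = A) (k : ℕ) (h : A ^ k * N = 0) : A * N = 0 := by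
  have hsq : ∀ Y : Matrix B B ℚ, A * (A * Y) = 0 → A * Y = 0 := by
    intro Y hY
    have h0 : (A * Y).transpose * (A * Y) = 0 := by
      rw [Matrix.transpose_mul, hA, mul_assoc, hY, mul_zero]
    ext i j
    have h1 := congrFun (congrFun h0 j) j
    rw [Matrix.mul_apply] at h1
    have h2 := (Finset.sum_eq_zero_iff_of_nonneg
      (fun b _ => by rw [Matrix.transpose_apply]; exact mul_self_nonneg _)).1 h1 i
        (Finset.mem_univ i)
    simpa using h2
  induction k with
  | zero => rw [pow_zero, one_mul] at h; rw [h, mul_zero]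
  | succ k ih =>
    rcases k with _ | k
    · simpa using h
    · refine ih ?_
      rw [pow_succ', pow_succ', mul_assoc, mul_assoc] at h
      rw [pow_succ', mul_assoc]
      exact hsq _ h

/-- A polynomial in a symmetric matrix projecting, up to a nonzero scalar, to an eigenspace. -/
lemma Matrix.exists_aeval_mul_eq_zero {B : Type*} [Fintype B] [DecidableEq B]
    {A : Matrix B B ℚ} (hA : A.transpose = A) (c : ℚ) :
    ∃ q : Polynomial ℚ, q.eval c ≠ 0 ∧
      (A - algebraMap ℚ (Matrix B B ℚ) c) * Polynomial.aeval A q = 0 := by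
  obtain ⟨q, hq, hnd⟩ := A.charpoly.exists_eq_pow_rootMultiplicity_mul_and_not_dvd
    A.charpoly_monic.ne_zero c
  refine ⟨q, fun h => hnd (Polynomial.dvd_iff_isRoot.2 h), ?_⟩
  have h0 := A.aeval_self_charpoly
  rw [hq] at h0
  refine Matrix.mul_eq_zero_of_pow_mul_eq_zero ?_ (A.charpoly.rootMultiplicity c)
    (by simpa using h0)
  rw [Matrix.transpose_sub, hA]
  simp [Matrix.algebraMap_eq_diagonal]

lemma Matrix.transpose_aeval {B : Type*} [Fintype B] [DecidableEq B]
    {A : Matrix B B ℚ} (hA : A.transpose = A) (q : Polynomial ℚ) :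
    (Polynomial.aeval A q).transpose = Polynomial.aeval A q := by
  induction q using Polynomial.induction_on' with
  | add p q hp hq => simp [hp, hq]
  | monomial k a =>
    rw [Polynomial.aeval_monomial, Matrix.transpose_mul, Matrix.transpose_pow, hA,
      Matrix.algebraMap_eq_diagonal, Matrix.diagonal_transpose, ← Matrix.algebraMap_eq_diagonal,
      Algebra.commutes]

namespace WeightModule

variable {n m : ℕ} {B : Type*} [Fintype B] [DecidableEq B]
  {U : WeightModule (Fin n ⊕ Fin m) B}

lemma isInvariant_casimir_pow (k : ℕ) : U.IsInvariant (U.casimir ^ k) := by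
  induction k with
  | zero => exact ⟨fun _ _ => by simp, fun _ _ => by simp⟩
  | succ k ih => rw [pow_succ]; exact ih.mul U.isInvariant_casimir

lemma IsInvariant.coeff_alternant_mul_wtrace_aeval {S : Matrix B B ℚ} (hS : U.IsInvariant S)
    (q : Polynomial ℚ) (κ : Fin n ⊕ Fin m →₀ ℕ) :
    coeff κ (alternant (stair n m) * U.wtrace (S * Polynomial.aeval U.casimir q)) =
      q.eval (∑ i, (κ i : ℚ) ^ 2 - ∑ i, (stair n m i : ℚ) ^ 2) *
        coeff κ (alternant (stair n m) * U.wtrace S) := by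
  induction q using Polynomial.induction_on' with
  | add p q hp hq => simp [mul_add, wtrace_add, hp, hq, add_mul]
  | monomial k a =>
    have h : ∀ k, coeff κ (alternant (stair n m) * U.wtrace (S * U.casimir ^ k)) =
        (∑ i, (κ i : ℚ) ^ 2 - ∑ i, (stair n m i : ℚ) ^ 2) ^ k *
          coeff κ (alternant (stair n m) * U.wtrace S) := by
      intro k
      induction k with
      | zero => simp
      | succ k ih =>
        rw [pow_succ, ← mul_assoc,
          (hS.mul (isInvariant_casimir_pow k)).coeff_alternant_mul_wtrace_casimir, ih]
        ring
    rw [Polynomial.aeval_monomial, ← Algebra.smul_def, mul_smul_comm, wtrace_smul,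
      mul_left_comm, coeff_C_mul, h, Polynomial.eval_monomial]
    ring

/-- The coefficients of the Schur expansion of the weighted trace of an invariant positive
semidefinite matrix are nonnegative. -/
theorem coeff_alternant_mul_wtrace_nonneg {D : Type*} [Fintype D] {M : Matrix D B ℚ}
    (hM : U.IsInvariant (M.transpose * M)) (lam : Fin n ⊕ Fin m →₀ ℕ)
    (hlam : StrictAnti (addStair lam)) :
    0 ≤ coeff (addStair lam) (alternant (stair n m) * U.wtrace (M.transpose * M)) := by
  set c : ℚ := ∑ i, (addStair lam i : ℚ) ^ 2 - ∑ i, (stair n m i : ℚ) ^ 2 with hc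
  obtain ⟨q, hq, hzero⟩ := Matrix.exists_aeval_mul_eq_zero U.transpose_casimir c
  set P := Polynomial.aeval U.casimir q with hP
  have hPt : P.transpose = P := Matrix.transpose_aeval U.transpose_casimir q
  have hcomm : Commute (M.transpose * M) P :=
    Algebra.commute_of_mem_adjoin_singleton_of_commute (R := ℚ)
      (Polynomial.aeval_mem_adjoin_singleton _ _) hM.commute_casimir
  set g := U.wtrace (M.transpose * M * Polynomial.aeval U.casimir (q * q)) with hg
  have hpos : ∀ ν, 0 ≤ coeff ν g := by
    intro ν
    have h1 : M.transpose * M * Polynomial.aeval U.casimir (q * q) =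
        (M * P).transpose * (M * P) := by
      rw [map_mul, ← mul_assoc, ← hP, hcomm.eq, Matrix.transpose_mul, hPt]
      simp only [Matrix.mul_assoc]
    rw [hg, h1, wtrace, coeff_sum]
    refine Finset.sum_nonneg fun b _ => ?_
    rw [coeff_monomial]
    split_ifs
    · rw [Matrix.mul_apply]
      exact Finset.sum_nonneg fun d _ => mul_self_nonneg ((M * P) d b)
    · exact le_rfl
  have hnn := coeff_alternant_stair_mul_nonneg lam hlam g hpos fun ν hν => by
    have h2 := hM.coeff_alternant_mul_wtrace_aeval (q * q) (addStair ν)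
    have h3 := hM.coeff_alternant_mul_wtrace_aeval ((Polynomial.X - Polynomial.C c) * q)
      (addStair ν)
    rw [map_mul, map_sub, Polynomial.aeval_X, Polynomial.aeval_C, hzero] at h3
    rw [hg, h2] at hν
    have h4 : U.wtrace (M.transpose * M * 0) = 0 := by simp [wtrace]
    rw [h4, mul_zero, coeff_zero, Polynomial.eval_mul] at h3
    rw [Polynomial.eval_mul] at hν
    have h5 := (mul_eq_zero.1 h3.symm).resolve_right (right_ne_zero_of_mul hν)
    have h6 := (mul_eq_zero.1 h5).resolve_right (left_ne_zero_of_mul (left_ne_zero_of_mul hν))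
    simp only [Polynomial.eval_sub, Polynomial.eval_X, Polynomial.eval_C, hc] at h6
    linarith
  rw [hg, hM.coeff_alternant_mul_wtrace_aeval, Polynomial.eval_mul, ← hc] at hnn
  exact nonneg_of_mul_nonneg_right hnn (mul_self_pos.2 hq)

end WeightModule

namespace Matrix

variable {p : ℕ} {J : Type*} [Fintype J] [DecidableEq J]

/-- The tensor product of `p` square matrices, acting on words of length `p`. -/
def tens (A : Fin p → Matrix J J ℚ) : Matrix (Fin p → J) (Fin p → J) ℚ :=
  of fun w w' => ∏ a, A a (w a) (w' a)

lemma tens_apply (A : Fin p → Matrix J J ℚ) (w w' : Fin p → J) :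
    tens A w w' = ∏ a, A a (w a) (w' a) := rfl

lemma tens_mul_tens (A A' : Fin p → Matrix J J ℚ) :
    tens A * tens A' = tens fun a => A a * A' a := by
  ext w w'
  simp only [mul_apply, tens_apply, ← Finset.prod_mul_distrib]
  rw [Finset.prod_univ_sum, Fintype.piFinset_univ]

lemma tens_transpose (A : Fin p → Matrix J J ℚ) :
    (tens A).transpose = tens fun a => (A a).transpose := rfl

lemma tens_update_apply (A : Fin p → Matrix J J ℚ) (a : Fin p) (Y : Matrix J J ℚ)
    (w w' : Fin p → J) :
    tens (Function.update A a Y) w w' =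
      Y (w a) (w' a) * ∏ b ∈ Finset.univ.erase a, A b (w b) (w' b) := by
  rw [tens_apply, ← Finset.mul_prod_erase _ _ (Finset.mem_univ a), Function.update_self]
  congr 1
  refine Finset.prod_congr rfl fun b hb => ?_
  rw [Function.update_of_ne (Finset.ne_of_mem_erase hb)]

lemma tens_update_sub (A : Fin p → Matrix J J ℚ) (a : Fin p) (Y Z : Matrix J J ℚ) :
    tens (Function.update A a (Y - Z)) =
      tens (Function.update A a Y) - tens (Function.update A a Z) := by
  ext w w'
  simp only [tens_update_apply, sub_apply, sub_mul]

lemma tens_update_zero (A : Fin p → Matrix J J ℚ) (a : Fin p) :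
    tens (Function.update A a 0) = 0 := by
  ext w w'
  simp only [tens_update_apply, zero_apply, zero_mul]

/-- The action of a matrix on words of length `p` as a derivation. -/
def tot (p : ℕ) (Y : Matrix J J ℚ) : Matrix (Fin p → J) (Fin p → J) ℚ :=
  ∑ a, tens (Function.update 1 a Y)

lemma tot_sub (Y Z : Matrix J J ℚ) : tot p (Y - Z) = tot p Y - tot p Z := by
  simp only [tot, tens_update_sub, Finset.sum_sub_distrib]

lemma tot_zero : tot p (0 : Matrix J J ℚ) = 0 := by
  simp only [tot, tens_update_zero, Finset.sum_const_zero]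

lemma tot_transpose (Y : Matrix J J ℚ) : (tot p Y).transpose = tot p Y.transpose := by
  simp only [tot, transpose_sum, tens_transpose]
  refine Finset.sum_congr rfl fun a _ => congrArg tens ?_
  ext b : 1
  rcases eq_or_ne b a with rfl | h
  · simp
  · simp [Function.update_of_ne h]

lemma tens_mul_tot_sub_tot_mul_tens (A : Fin p → Matrix J J ℚ) (Y : Matrix J J ℚ) :
    tens A * tot p Y - tot p Y * tens A =
      ∑ a, tens (Function.update A a (A a * Y - Y * A a)) := by
  simp only [tot, Finset.mul_sum, Finset.sum_mul, ← Finset.sum_sub_distrib, tens_mul_tens,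
    tens_update_sub]
  refine Finset.sum_congr rfl fun a _ => ?_
  congr 2 <;>
  · ext b : 1
    rcases eq_or_ne b a with rfl | h
    · simp
    · simp [Function.update_of_ne h]

lemma tot_mul_tot_sub (Y Z : Matrix J J ℚ) :
    tot p Y * tot p Z - tot p Z * tot p Y = tot p (Y * Z - Z * Y) := by
  have h : tot p Y * tot p Z - tot p Z * tot p Y =
      ∑ a, (tens (Function.update 1 a Y) * tot p Z - tot p Z * tens (Function.update 1 a Y)) := by
    rw [Finset.sum_sub_distrib, ← Finset.sum_mul, ← Finset.mul_sum, tot]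
  rw [h]
  refine Finset.sum_congr rfl fun a _ => ?_
  rw [tens_mul_tot_sub_tot_mul_tens, Finset.sum_eq_single a]
  · simp
  · intro b _ hb
    rw [Function.update_of_ne hb]
    simp [tens_update_zero]
  · simp

lemma tens_update_one_apply (a : Fin p) (Y : Matrix J J ℚ) (w w' : Fin p → J) :
    tens (Function.update 1 a Y) w w' =
      if ∀ b, b ≠ a → w b = w' b then Y (w a) (w' a) else 0 := by
  rw [tens_update_apply]
  simp only [Pi.one_apply, one_apply]
  rw [Finset.prod_ite_zero]
  simp

lemma mul_tot_apply (S : Matrix (Fin p → J) (Fin p → J) ℚ) (Y : Matrix J J ℚ)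
    (w w' : Fin p → J) :
    (S * tot p Y) w w' = ∑ a, ∑ y, S w (Function.update w' a y) * Y y (w' a) := by
  rw [tot, Finset.mul_sum, sum_apply]
  refine Finset.sum_congr rfl fun a _ => ?_
  refine (Finset.sum_subset (f := fun u => S w u * tens (Function.update 1 a Y) u w')
    (Finset.subset_univ (Finset.univ.image fun y => Function.update w' a y)) ?_).symm.trans ?_
  rotate_left
  · rw [Finset.sum_image (Function.update_injective w' a).injOn]
    refine Finset.sum_congr rfl fun y _ => ?_
    rw [tens_update_one_apply, if_pos fun b hb => Function.update_of_ne hb _ _]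
    simp
  · intro u _ hu
    rw [tens_update_one_apply, if_neg, mul_zero]
    intro h
    refine hu (Finset.mem_image.2 ⟨u a, Finset.mem_univ _, ?_⟩)
    ext b
    rcases eq_or_ne b a with rfl | hb
    · simp
    · rw [Function.update_of_ne hb, h b hb]

lemma tot_mul_apply (S : Matrix (Fin p → J) (Fin p → J) ℚ) (Y : Matrix J J ℚ)
    (w w' : Fin p → J) :
    (tot p Y * S) w w' = ∑ a, ∑ y, Y (w a) y * S (Function.update w a y) w' := by
  have h := mul_tot_apply S.transpose Y.transpose w' w
  rw [← tot_transpose, ← transpose_mul, transpose_apply] at h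
  rw [h]
  simp only [transpose_apply, mul_comm]

/-- The place permutation matrix on words. -/
def placePerm (J : Type*) [DecidableEq J] (σ : Equiv.Perm (Fin p)) :
    Matrix (Fin p → J) (Fin p → J) ℚ :=
  of fun v v' => if v = v' ∘ σ then 1 else 0

lemma placePerm_mul_tens (σ : Equiv.Perm (Fin p)) (A : Fin p → Matrix J J ℚ) :
    placePerm J σ * tens A = tens (A ∘ σ) * placePerm J σ := by
  ext v v'
  simp only [mul_apply, placePerm, of_apply]
  rw [Finset.sum_eq_single (v ∘ σ.symm), Finset.sum_eq_single (v' ∘ σ)]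
  · have h : v = (v ∘ σ.symm) ∘ σ := by ext; simp
    rw [if_pos h, if_pos rfl, one_mul, mul_one, tens_apply, tens_apply]
    rw [← Equiv.prod_comp σ]
    simp
  · intro u _ hu
    rw [if_neg hu, mul_zero]
  · simp
  · intro u _ hu
    rw [if_neg, zero_mul]
    rintro rfl
    exact hu (by ext; simp)
  · simp

lemma commute_placePerm_tot (σ : Equiv.Perm (Fin p)) (Y : Matrix J J ℚ) :
    Commute (placePerm J σ) (tot p Y) := by
  rw [commute_iff_eq, tot, Finset.mul_sum, Finset.sum_mul, ← Equiv.sum_comp σ]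
  refine Finset.sum_congr rfl fun a _ => ?_
  rw [placePerm_mul_tens]
  congr 2
  ext b : 1
  rcases eq_or_ne b a with rfl | h
  · simp
  · simp [Function.update_of_ne h, Function.update_of_ne (σ.injective.ne h)]

/-- The antisymmetrizer on words. -/
def antisymmetrizer (p : ℕ) (J : Type*) [DecidableEq J] :
    Matrix (Fin p → J) (Fin p → J) ℚ :=
  ∑ σ : Equiv.Perm (Fin p), ((Equiv.Perm.sign σ : ℤ) : ℚ) • placePerm J σ

lemma commute_antisymmetrizer_tot (Y : Matrix J J ℚ) :
    Commute (antisymmetrizer p J) (tot p Y) :=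
  Commute.sum_left _ _ _ fun σ _ => (commute_placePerm_tot σ Y).smul_left _

lemma trace_antisymmetrizer_mul_tens (A : Fin p → Matrix J J ℚ) :
    trace (antisymmetrizer p J * tens A) =
      ∑ v : Fin p → J, ∑ σ : Equiv.Perm (Fin p), ((Equiv.Perm.sign σ : ℤ) : ℚ) *
        ∏ a, A a (v a) (v (σ a)) := by
  rw [antisymmetrizer, Finset.sum_mul, trace_sum, Finset.sum_comm]
  refine Finset.sum_congr rfl fun σ _ => ?_
  rw [smul_mul_assoc, trace_smul, smul_eq_mul, trace_mul_comm, ← Finset.mul_sum]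
  congr 1
  rw [trace]
  refine Finset.sum_congr rfl fun v _ => ?_
  rw [diag_apply, mul_apply, Finset.sum_eq_single (v ∘ σ)]
  · simp [placePerm, tens_apply]
  · intro u _ hu
    simp [placePerm, hu]
  · simp

end Matrix

section Words

variable {I : Type*} [DecidableEq I] [Fintype I] {p : ℕ}

lemma Matrix.tot_single_diag (p : ℕ) (i : I) :
    Matrix.tot p (Matrix.single i i (1 : ℚ)) =
      Matrix.diagonal fun w : Fin p → I => (((∑ a, Finsupp.single (w a) 1 : I →₀ ℕ) i : ℕ) : ℚ) := by
  ext w w'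
  rw [Matrix.tot, Matrix.sum_apply, Matrix.diagonal_apply]
  simp only [Matrix.tens_update_one_apply]
  rcases eq_or_ne w w' with rfl | h
  · rw [if_pos rfl, Finsupp.finsetSum_apply, Nat.cast_sum]
    refine Finset.sum_congr rfl fun a _ => ?_
    rw [if_pos fun _ _ => rfl, Matrix.single_apply, Finsupp.single_apply]
    simp [eq_comm]
  · rw [if_neg h]
    refine Finset.sum_eq_zero fun a _ => ?_
    split_ifs with hb
    · rw [Matrix.single_apply, if_neg]
      rintro ⟨h1, h2⟩
      refine h (funext fun b => ?_)
      rcases eq_or_ne b a with rfl | hba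
      · rw [← h1, ← h2]
      · exact hb b hba
    · rfl

/-- The `p`-th tensor power of the defining representation of `gl_I`. -/
noncomputable def WeightModule.words (I : Type*) [DecidableEq I] [Fintype I] (p : ℕ) :
    WeightModule I (Fin p → I) where
  wt w := ∑ a, Finsupp.single (w a) 1
  E i j := Matrix.tot p (Matrix.single i j 1)
  comm i j k l := by
    rw [Matrix.tot_mul_tot_sub, Matrix.tot_sub]
    congr 1
    · split_ifs with h
      · subst h; simp
      · rw [Matrix.single_mul_single_of_ne _ _ _ _ h, Matrix.tot_zero]
    · split_ifs with h
      · subst h; simp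
      · rw [Matrix.single_mul_single_of_ne _ _ _ _ h, Matrix.tot_zero]
  transpose_E i j := by rw [Matrix.tot_transpose, Matrix.transpose_single]
  E_diag i := Matrix.tot_single_diag p i
  weight_E i j w w' h := by
    rw [Matrix.tot, Matrix.sum_apply] at h
    obtain ⟨a, -, ha⟩ := Finset.exists_ne_zero_of_sum_ne_zero h
    rw [Matrix.tens_update_one_apply] at ha
    split_ifs at ha with hb
    · rw [Matrix.single_apply] at ha
      have hij : i = w a ∧ j = w' a := by
        by_contra hc
        exact ha (if_neg hc)
      rw [hij.1, hij.2, ← Finset.add_sum_erase _ _ (Finset.mem_univ a),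
        ← Finset.add_sum_erase (a := a) _ (fun b => Finsupp.single (w' b) 1) (Finset.mem_univ a),
        Finset.sum_congr rfl fun b hba => by rw [hb b (Finset.ne_of_mem_erase hba)]]
      abel
    · exact absurd rfl ha

/-- The matrix with entries `tr (Alt · ρ (w 1) (w' 1) ⊗ ⋯ ⊗ ρ (w p) (w' p))`. -/
def altTrace {J : Type*} [Fintype J] [DecidableEq J] (ρ : I → I → Matrix J J ℚ) (p : ℕ) :
    Matrix (Fin p → I) (Fin p → I) ℚ :=
  Matrix.of fun w w' =>
    Matrix.trace (Matrix.antisymmetrizer p J * Matrix.tens fun a => ρ (w a) (w' a))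

lemma commute_altTrace {J : Type*} [Fintype J] [DecidableEq J] (ρ : I → I → Matrix J J ℚ)
    (i j : I) (h : ∀ k l, ρ k l * ρ i j - ρ i j * ρ k l =
      (if l = i then ρ k j else 0) - (if j = k then ρ i l else 0)) :
    Commute (altTrace ρ p) (Matrix.tot p (Matrix.single j i 1)) := by
  rw [commute_iff_eq, ← sub_eq_zero]
  ext w w'
  rw [Matrix.sub_apply, Matrix.mul_tot_apply, Matrix.tot_mul_apply, ← Finset.sum_sub_distrib,
    Matrix.zero_apply]
  set R : Fin p → Matrix J J ℚ := fun a => ρ (w a) (w' a) with hR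
  have key : ∀ a, (∑ y, altTrace ρ p w (Function.update w' a y) * Matrix.single j i 1 y (w' a) -
      ∑ y, Matrix.single j i 1 (w a) y * altTrace ρ p (Function.update w a y) w') =
      Matrix.trace (Matrix.antisymmetrizer p J *
        Matrix.tens (Function.update R a (R a * ρ i j - ρ i j * R a))) := by
    intro a
    rw [hR, h, Matrix.tens_update_sub, Matrix.mul_sub, Matrix.trace_sub]
    congr 1
    · rw [Finset.sum_eq_single j]
      · split_ifs with hi
        · rw [hi, Matrix.single_apply_same, mul_one, altTrace, Matrix.of_apply]
          congr 3
          ext b : 1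
          rcases eq_or_ne b a with rfl | hb
          · simp
          · simp [Function.update_of_ne hb]
        · rw [Matrix.tens_update_zero, mul_zero, Matrix.trace_zero, Matrix.single_apply,
            if_neg fun hc => hi hc.2.symm, mul_zero]
      · intro y _ hy
        rw [Matrix.single_apply, if_neg fun hc => hy hc.1.symm, mul_zero]
      · simp
    · rw [Finset.sum_eq_single i]
      · split_ifs with hi
        · rw [← hi, Matrix.single_apply_same, one_mul, altTrace, Matrix.of_apply]
          congr 3
          ext b : 1
          rcases eq_or_ne b a with rfl | hb
          · simp
          · simp [Function.update_of_ne hb]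
        · rw [Matrix.tens_update_zero, mul_zero, Matrix.trace_zero, Matrix.single_apply,
            if_neg fun hc => hi hc.1, zero_mul]
      · intro y _ hy
        rw [Matrix.single_apply, if_neg fun hc => hy hc.2.symm, zero_mul]
      · simp
  rw [Finset.sum_congr rfl fun a _ => key a, ← Matrix.trace_sum, ← Finset.mul_sum,
    ← Matrix.tens_mul_tot_sub_tot_mul_tens, mul_sub, Matrix.trace_sub, ← mul_assoc, ← mul_assoc,
    (Matrix.commute_antisymmetrizer_tot (ρ i j)).eq, mul_assoc (Matrix.tot p (ρ i j)),
    Matrix.trace_mul_comm (Matrix.tot p (ρ i j)), sub_self]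

end Words

section Gram

variable {I : Type*} [DecidableEq I] [Fintype I] {p : ℕ}
  {V R : Type*} [Fintype V] [DecidableEq V] [Fintype R] [DecidableEq R]

/-- A square root, up to a factor `p!`, of `altTrace` for `ρ i j = (c i)ᵀ * c j`. -/
def altRoot (c : I → Matrix R V ℚ) (p : ℕ) : Matrix ((Fin p → R) × (Fin p → V)) (Fin p → I) ℚ :=
  Matrix.of fun rv w => ∑ τ : Equiv.Perm (Fin p),
    ((Equiv.Perm.sign τ : ℤ) : ℚ) * ∏ a, c (w a) (rv.1 a) (rv.2 (τ a))

lemma altTrace_apply (ρ : I → I → Matrix V V ℚ) (w w' : Fin p → I) :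
    altTrace ρ p w w' = ∑ v : Fin p → V, ∑ σ : Equiv.Perm (Fin p),
      ((Equiv.Perm.sign σ : ℤ) : ℚ) * ∏ a, ρ (w a) (w' a) (v a) (v (σ a)) := by
  rw [altTrace, Matrix.of_apply, Matrix.trace_antisymmetrizer_mul_tens]

lemma altRoot_gram (c : I → Matrix R V ℚ) (p : ℕ) :
    (altRoot c p).transpose * altRoot c p =
      (p.factorial : ℚ) • altTrace (fun i j => (c i).transpose * c j) p := by
  ext w w'
  have h1 : ((altRoot c p).transpose * altRoot c p) w w' =
      ∑ σ : Equiv.Perm (Fin p), ∑ τ : Equiv.Perm (Fin p), ∑ v : Fin p → V,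
        ((Equiv.Perm.sign σ : ℤ) : ℚ) * ((Equiv.Perm.sign τ : ℤ) : ℚ) *
          ∏ a, ((c (w a)).transpose * c (w' a)) (v (σ a)) (v (τ a)) := by
    simp only [Matrix.mul_apply, Matrix.transpose_apply, altRoot, Matrix.of_apply,
      Finset.sum_mul_sum]
    rw [Finset.sum_comm]
    refine Finset.sum_congr rfl fun σ _ => ?_
    rw [Finset.sum_comm]
    refine Finset.sum_congr rfl fun τ _ => ?_
    rw [Fintype.sum_prod_type_right]
    refine Finset.sum_congr rfl fun v _ => ?_
    rw [Finset.prod_univ_sum, Fintype.piFinset_univ, Finset.mul_sum]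
    refine Finset.sum_congr rfl fun r _ => ?_
    rw [Finset.prod_mul_distrib]
    ring
  rw [h1, Matrix.smul_apply, altTrace_apply, smul_eq_mul]
  have h2 : ∀ σ : Equiv.Perm (Fin p), (∑ τ : Equiv.Perm (Fin p), ∑ v : Fin p → V,
        ((Equiv.Perm.sign σ : ℤ) : ℚ) * ((Equiv.Perm.sign τ : ℤ) : ℚ) *
          ∏ a, ((c (w a)).transpose * c (w' a)) (v (σ a)) (v (τ a))) =
      ∑ v : Fin p → V, ∑ σ : Equiv.Perm (Fin p), ((Equiv.Perm.sign σ : ℤ) : ℚ) *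
        ∏ a, ((c (w a)).transpose * c (w' a)) (v a) (v (σ a)) := by
    intro σ
    rw [Finset.sum_comm, ← Equiv.sum_comp (Equiv.arrowCongr σ (Equiv.refl V))]
    refine Finset.sum_congr rfl fun v _ => ?_
    rw [← Equiv.sum_comp (Equiv.mulLeft σ)]
    refine Finset.sum_congr rfl fun π _ => ?_
    have : ((Equiv.Perm.sign σ : ℤ) : ℚ) * ((Equiv.Perm.sign σ : ℤ) : ℚ) = 1 := by
      rcases Int.units_eq_one_or (Equiv.Perm.sign σ) with h | h <;> simp [h]
    simp only [Equiv.coe_mulLeft, Equiv.Perm.sign_mul, Units.val_mul, Int.cast_mul,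
      ← mul_assoc, this, one_mul]
    simp [Equiv.arrowCongr_apply]
  rw [Finset.sum_congr rfl fun σ _ => h2 σ, Finset.sum_const, Finset.card_univ,
    Fintype.card_perm, Fintype.card_fin, nsmul_eq_mul]

lemma card_filter_injective_image_eq {F : Finset V} (hF : F.card = p) :
    (Finset.univ.filter fun v : Fin p → V =>
      Function.Injective v ∧ Finset.univ.image v = F).card = p.factorial := by
  have hc : Fintype.card F = p := by rw [Fintype.card_coe, hF]
  have e₀ : Fin p ≃ F := (finCongr hc.symm).trans (Fintype.equivFin F).symm
  rw [← Fintype.card_fin p, ← Fintype.card_equiv e₀, Fintype.card_fin, ← Finset.card_univ]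
  symm
  refine Finset.card_bij (fun e _ a => (e a : V)) ?_ ?_ ?_
  · intro e _
    refine Finset.mem_filter.2 ⟨Finset.mem_univ _, Subtype.val_injective.comp e.injective, ?_⟩
    ext x
    simp only [Finset.mem_image, Finset.mem_univ, true_and]
    exact ⟨fun ⟨a, ha⟩ => ha ▸ (e a).2, fun hx => ⟨e.symm ⟨x, hx⟩, by simp⟩⟩
  · intro e _ e' _ h
    ext a
    exact congrFun h a
  · intro v hv
    obtain ⟨-, hinj, him⟩ := Finset.mem_filter.1 hv
    have hmem : ∀ a, v a ∈ F := fun a => him ▸ Finset.mem_image_of_mem v (Finset.mem_univ a)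
    refine ⟨Equiv.ofBijective (fun a => (⟨v a, hmem a⟩ : F)) ⟨?_, ?_⟩, Finset.mem_univ _, rfl⟩
    · intro a b h
      exact hinj (congrArg Subtype.val h)
    · rintro ⟨x, hx⟩
      rw [← him] at hx
      obtain ⟨a, -, rfl⟩ := Finset.mem_image.1 hx
      exact ⟨a, rfl⟩

lemma sum_injective_prod {S : Type*} [CommRing S] (L : V → S) (p : ℕ) :
    ∑ v : Fin p → V with Function.Injective v, ∏ a, L (v a) =
      (p.factorial : S) * ∑ F ∈ (Finset.univ : Finset V).powersetCard p, ∏ x ∈ F, L x := by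
  rw [← Finset.sum_fiberwise_of_maps_to (t := (Finset.univ : Finset V).powersetCard p)
    (g := fun v => Finset.univ.image v), Finset.mul_sum]
  · refine Finset.sum_congr rfl fun F hF => ?_
    rw [← card_filter_injective_image_eq (Finset.mem_powersetCard.1 hF).2, ← nsmul_eq_mul,
      ← Finset.sum_const, Finset.filter_filter]
    refine Finset.sum_congr rfl fun v hv => ?_
    obtain ⟨-, hinj, him⟩ := Finset.mem_filter.1 hv
    rw [← him, Finset.prod_image hinj.injOn]
  · intro v hv
    rw [Finset.mem_powersetCard, Finset.card_image_of_injective _ (Finset.mem_filter.1 hv).2]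
    simp

lemma sum_det_eq_sum_powersetCard {S : Type*} [CommRing S] (L : V → S) (p : ℕ) :
    ∑ v : Fin p → V, (Matrix.of fun a b => if v a = v b then L (v a) else 0).det =
      (p.factorial : S) * ∑ F ∈ (Finset.univ : Finset V).powersetCard p, ∏ x ∈ F, L x := by
  rw [← sum_injective_prod, Finset.sum_filter]
  refine Finset.sum_congr rfl fun v _ => ?_
  split_ifs with hv
  · rw [← Matrix.det_diagonal]
    congr 1
    ext a b
    simp [Matrix.diagonal_apply, hv.eq_iff]
  · simp only [Function.Injective, not_forall] at hv
    obtain ⟨a, b, hab, hne⟩ := hv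
    refine Matrix.det_zero_of_row_eq hne ?_
    ext d
    simp [hab]

lemma sum_monomial_altTrace (ρ : I → I → Matrix V V ℚ) (η : I → V → ℚ)
    (h : ∀ i, ρ i i = Matrix.diagonal (η i)) (p : ℕ) :
    ∑ w : Fin p → I, monomial (∑ a, Finsupp.single (w a) 1) (altTrace ρ p w w) =
      ∑ v : Fin p → V, (Matrix.of fun a b =>
        if v a = v b then ∑ i, C (η i (v a)) * X i else (0 : MvPolynomial I ℚ)).det := by
  have h1 : ∀ v : Fin p → V, (Matrix.of fun a b =>
        if v a = v b then ∑ i, C (η i (v a)) * X i else (0 : MvPolynomial I ℚ)).det =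
      ∑ w : Fin p → I, ∑ σ : Equiv.Perm (Fin p),
        C ((Equiv.Perm.sign σ : ℤ) : ℚ) * ∏ a, (C (ρ (w a) (w a) (v a) (v (σ a))) * X (w a)) := by
    intro v
    rw [← Matrix.det_transpose, Matrix.det_apply', Finset.sum_comm]
    refine Finset.sum_congr rfl fun σ _ => ?_
    rw [← Finset.mul_sum, ← Fintype.piFinset_univ, ← Finset.prod_univ_sum (fun _ => Finset.univ)
      (fun a i => C (ρ i i (v a) (v (σ a))) * X i), map_intCast]
    refine congrArg _ (Finset.prod_congr rfl fun a _ => ?_)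
    simp only [Matrix.transpose_apply, Matrix.of_apply, h, Matrix.diagonal_apply]
    split_ifs <;> simp
  rw [Finset.sum_congr rfl fun v _ => h1 v, Finset.sum_comm]
  refine Finset.sum_congr rfl fun w _ => ?_
  rw [monomial_sum_index, altTrace_apply]
  simp only [map_sum, map_mul, Finset.sum_mul, Finset.prod_mul_distrib, map_prod, mul_assoc, X]

end Gram

theorem coeff_alternant_mul_esymm_nonneg {n m : ℕ} {V R : Type*} [Fintype V] [DecidableEq V]
    [Fintype R] [DecidableEq R] (c : Fin n ⊕ Fin m → Matrix R V ℚ) (η : Fin n ⊕ Fin m → V → ℚ)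
    (hη : ∀ i, (c i).transpose * c i = Matrix.diagonal (η i))
    (hc : ∀ i j k l : Fin n ⊕ Fin m, i.isLeft = j.isLeft →
      ((c k).transpose * c l) * ((c i).transpose * c j) -
          ((c i).transpose * c j) * ((c k).transpose * c l) =
        (if l = i then (c k).transpose * c j else 0) - (if j = k then (c i).transpose * c l else 0))
    (p : ℕ) (lam : Fin n ⊕ Fin m →₀ ℕ) (hlam : StrictAnti (addStair lam)) :
    0 ≤ coeff (addStair lam) (alternant (stair n m) *
      ∑ F ∈ (Finset.univ : Finset V).powersetCard p, ∏ v ∈ F, ∑ i, C (η i v) * X i) := by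
  set U := WeightModule.words (Fin n ⊕ Fin m) p with hU
  set ρ : Fin n ⊕ Fin m → Fin n ⊕ Fin m → Matrix V V ℚ := fun i j => (c i).transpose * c j with hρ
  have hcomm : ∀ i j : Fin n ⊕ Fin m, i.isLeft = j.isLeft →
      Commute (altTrace ρ p) (U.E i j) := fun i j hij =>
    commute_altTrace ρ j i fun k l => hc j i k l hij.symm
  have hinv : U.IsInvariant ((altRoot c p).transpose * altRoot c p) := by
    rw [altRoot_gram]
    exact ⟨fun i j => (hcomm (.inl i) (.inl j) rfl).smul_left (p.factorial : ℚ),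
      fun i j => (hcomm (.inr i) (.inr j) rfl).smul_left (p.factorial : ℚ)⟩
  have h := U.coeff_alternant_mul_wtrace_nonneg hinv lam hlam
  have htr : U.wtrace (altTrace ρ p) = (p.factorial : MvPolynomial (Fin n ⊕ Fin m) ℚ) *
      ∑ F ∈ (Finset.univ : Finset V).powersetCard p, ∏ v ∈ F, ∑ i, C (η i v) * X i := by
    rw [← sum_det_eq_sum_powersetCard, ← sum_monomial_altTrace ρ η hη]
    rfl
  rw [altRoot_gram, WeightModule.wtrace_smul, htr, mul_left_comm, coeff_C_mul,
    mul_left_comm, ← map_natCast (C : ℚ →+* MvPolynomial (Fin n ⊕ Fin m) ℚ), coeff_C_mul] at h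
  have hp : (0 : ℚ) < p.factorial := by exact_mod_cast p.factorial_pos
  exact nonneg_of_mul_nonneg_right (nonneg_of_mul_nonneg_right h hp) hp

namespace Matrix

variable {p : ℕ} {J : Type*} [Fintype J] [DecidableEq J]

lemma tens_update_add (A : Fin p → Matrix J J ℚ) (a : Fin p) (Y Z : Matrix J J ℚ) :
    tens (Function.update A a (Y + Z)) =
      tens (Function.update A a Y) + tens (Function.update A a Z) := by
  ext w w'
  simp only [tens_update_apply, add_apply, add_mul]

lemma tens_one : tens (1 : Fin p → Matrix J J ℚ) = 1 := by
  ext w w'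
  simp only [tens_apply, Pi.one_apply, one_apply, Finset.prod_ite_zero, Finset.prod_const_one,
    Finset.mem_univ, true_imp_iff, funext_iff]

lemma tens_add_tens_eq_zero {A A' : Fin p → Matrix J J ℚ} (a : Fin p) (ha : A a + A' a = 0)
    (h : ∀ b, b ≠ a → A b = A' b) : tens A + tens A' = 0 := by
  rw [← Function.update_eq_self a A, ← Function.update_eq_self a A',
    show Function.update A' a (A' a) = Function.update A a (A' a) from ?_, ← tens_update_add, ha,
    tens_update_zero]
  ext b : 1
  rcases eq_or_ne b a with rfl | hb
  · simp
  · simp [Function.update_of_ne hb, h b hb]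

end Matrix

section Fermions

/-- The lowering matrix. -/
def lowering : Matrix (Fin 2) (Fin 2) ℚ := !![0, 1; 0, 0]

/-- The parity matrix. -/
def parity : Matrix (Fin 2) (Fin 2) ℚ := !![1, 0; 0, -1]

/-- The Jordan–Wigner annihilation matrices. -/
def annihilator {p : ℕ} (i : Fin p) : Matrix (Fin p → Fin 2) (Fin p → Fin 2) ℚ :=
  Matrix.tens fun b => if b < i then parity else if b = i then lowering else 1

lemma parity_mul_lowering : parity * lowering + lowering * parity = 0 := by
  ext x y; fin_cases x <;> fin_cases y <;> simp [parity, lowering]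

lemma parity_transpose : parity.transpose = parity := by
  ext i j; fin_cases i <;> fin_cases j <;> simp [parity]

lemma parity_mul_parity : parity * parity = 1 := by
  simp [parity, Matrix.one_fin_two]

lemma lowering_mul_lowering : lowering * lowering = 0 := by
  ext x y; fin_cases x <;> fin_cases y <;> simp [lowering, Matrix.mul_apply]

lemma lowering_mul_transpose :
    lowering * lowering.transpose + lowering.transpose * lowering = 1 := by
  ext x y
  rw [Matrix.add_apply, Matrix.mul_apply, Matrix.mul_apply]
  fin_cases x <;> fin_cases y <;> simp [lowering]

variable {p : ℕ}

lemma annihilator_transpose (i : Fin p) : (annihilator i).transpose =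
    Matrix.tens fun b => if b < i then parity else if b = i then lowering.transpose else 1 := by
  rw [annihilator, Matrix.tens_transpose]
  congr 1
  ext b : 1
  split_ifs
  · exact parity_transpose
  · rfl
  · exact Matrix.transpose_one

lemma annihilator_anticomm (i j : Fin p) :
    annihilator i * annihilator j + annihilator j * annihilator i = 0 := by
  wlog hij : i ≤ j generalizing i j
  · rw [add_comm]
    exact this j i (le_of_not_ge hij)
  rw [annihilator, annihilator, Matrix.tens_mul_tens, Matrix.tens_mul_tens]
  refine Matrix.tens_add_tens_eq_zero i ?_ ?_
  · rcases hij.lt_or_eq with h | rfl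
    · simp [h, add_comm (lowering * _), parity_mul_lowering]
    · simp [lowering_mul_lowering]
  · intro b hb
    rcases lt_or_gt_of_ne hb with h | h
    · simp [h, h.trans_le hij]
    · simp [h.not_gt, hb]

lemma annihilator_transpose_anticomm_of_lt {i j : Fin p} (h : i < j) :
    annihilator i * (annihilator j).transpose + (annihilator j).transpose * annihilator i = 0 := by
  rw [annihilator_transpose, annihilator, Matrix.tens_mul_tens, Matrix.tens_mul_tens]
  refine Matrix.tens_add_tens_eq_zero i ?_ ?_
  · simp [h, add_comm (lowering * _), parity_mul_lowering]
  · intro b hb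
    rcases lt_or_gt_of_ne hb with h' | h'
    · simp [h', h'.trans h]
    · simp [h'.not_gt, hb]

lemma annihilator_transpose_mul_self (i : Fin p) : (annihilator i).transpose * annihilator i =
    Matrix.tens (Function.update 1 i (lowering.transpose * lowering)) := by
  rw [annihilator_transpose, annihilator, Matrix.tens_mul_tens]
  congr 1
  ext b : 1
  rcases lt_trichotomy b i with h | rfl | h
  · simp [h, h.ne, parity_mul_parity]
  · simp
  · simp [h.not_gt, h.ne']

lemma annihilator_mul_transpose_self (i : Fin p) : annihilator i * (annihilator i).transpose =
    Matrix.tens (Function.update 1 i (lowering * lowering.transpose)) := by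
  rw [annihilator_transpose, annihilator, Matrix.tens_mul_tens]
  congr 1
  ext b : 1
  rcases lt_trichotomy b i with h | rfl | h
  · simp [h, h.ne, parity_mul_parity]
  · simp
  · simp [h.not_gt, h.ne']

lemma annihilator_transpose_anticomm (i j : Fin p) :
    annihilator i * (annihilator j).transpose + (annihilator j).transpose * annihilator i =
      if i = j then 1 else 0 := by
  rcases lt_trichotomy i j with h | rfl | h
  · rw [annihilator_transpose_anticomm_of_lt h, if_neg h.ne]
  · rw [annihilator_transpose_mul_self, annihilator_mul_transpose_self,
      ← Matrix.tens_update_add, lowering_mul_transpose, if_pos rfl]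
    exact (congrArg Matrix.tens (Function.update_eq_self i 1)).trans Matrix.tens_one
  · have := congrArg Matrix.transpose (annihilator_transpose_anticomm_of_lt h)
    rw [if_neg h.ne', ← Matrix.transpose_zero, ← this]
    simp [Matrix.transpose_mul]

lemma annihilator_number (i : Fin p) : (annihilator i).transpose * annihilator i =
    Matrix.diagonal fun v => if v i = 1 then 1 else 0 := by
  have h : lowering.transpose * lowering = Matrix.diagonal fun x => if x = 1 then 1 else 0 := by
    ext x y; fin_cases x <;> fin_cases y <;> simp [lowering, Matrix.mul_apply]
  ext v v'
  rw [annihilator_transpose_mul_self, Matrix.tens_update_one_apply, h, Matrix.diagonal_apply,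
    Matrix.diagonal_apply]
  rcases eq_or_ne v v' with rfl | hv
  · simp
  · rw [if_neg hv]
    split_ifs with h1 h2 h3 <;> first | rfl | skip
    refine absurd (_root_.funext fun b => ?_) hv
    rcases eq_or_ne b i with rfl | hb
    · exact h2
    · exact h1 b hb

/-- The indicator function of a finite set, read along an enumeration of the ambient type. -/
def indicatorEquiv {I : Type*} [Fintype I] [DecidableEq I] (e : I ≃ Fin p) :
    Finset I ≃ (Fin p → Fin 2) where
  toFun S b := if e.symm b ∈ S then 1 else 0
  invFun v := Finset.univ.filter fun i => v (e i) = 1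
  left_inv S := by ext i; simp
  right_inv v := by
    ext b : 1
    have : v b = 0 ∨ v b = 1 := by omega
    rcases this with h | h <;> simp [h]

theorem exists_annihilators (I : Type*) [Fintype I] [DecidableEq I] :
    ∃ c : I → Matrix (Finset I) (Finset I) ℚ,
      (∀ i j, c i * c j + c j * c i = 0) ∧
      (∀ i j, c i * (c j).transpose + (c j).transpose * c i = if i = j then 1 else 0) ∧
      ∀ i, (c i).transpose * c i = Matrix.diagonal fun S => if i ∈ S then 1 else 0 := by
  have e := Fintype.equivFin I
  set φ := indicatorEquiv e
  refine ⟨fun i => (annihilator (e i)).submatrix φ φ, fun i j => ?_, fun i j => ?_, fun i => ?_⟩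
  · rw [Matrix.submatrix_mul_equiv, Matrix.submatrix_mul_equiv]
    exact congrArg (fun A => A.submatrix φ φ) (annihilator_anticomm (e i) (e j))
  · rw [Matrix.transpose_submatrix, Matrix.submatrix_mul_equiv, Matrix.submatrix_mul_equiv]
    refine (congrArg (fun A => A.submatrix φ φ)
      (annihilator_transpose_anticomm (e i) (e j))).trans ?_
    simp only [e.injective.eq_iff]
    split_ifs
    · exact Matrix.submatrix_one_equiv φ
    · rfl
  · rw [Matrix.transpose_submatrix, Matrix.submatrix_mul_equiv, annihilator_number,
      Matrix.submatrix_diagonal_equiv]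
    congr 1
    ext S
    simp [φ, indicatorEquiv]

end Fermions

lemma bilinear_comm {A I : Type*} [Ring A] [DecidableEq I] (c d : I → A)
    (h1 : ∀ i j, c i * c j + c j * c i = 0) (h2 : ∀ i j, d i * d j + d j * d i = 0)
    (h3 : ∀ i j, c i * d j + d j * c i = if i = j then 1 else 0) (i j k l : I) :
    (d k * c l) * (d i * c j) - (d i * c j) * (d k * c l) =
      (if l = i then d k * c j else 0) - (if j = k then d i * c l else 0) := by
  have e1 : (d k * c l) * (d i * c j) = (if l = i then d k * c j else 0) - d k * d i * (c l * c j) := by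
    rw [show d k * c l * (d i * c j) = d k * (c l * d i) * c j by noncomm_ring,
      eq_sub_of_add_eq (h3 l i)]
    split_ifs <;> noncomm_ring
  have e2 : (d i * c j) * (d k * c l) = (if j = k then d i * c l else 0) - d i * d k * (c j * c l) := by
    rw [show d i * c j * (d k * c l) = d i * (c j * d k) * c l by noncomm_ring,
      eq_sub_of_add_eq (h3 j k)]
    split_ifs <;> noncomm_ring
  rw [e1, e2, eq_neg_of_add_eq_zero_left (h1 j l), eq_neg_of_add_eq_zero_left (h2 i k), neg_mul_neg]
  abel

lemma bilinear_commute_sum {A I : Type*} [Ring A] [DecidableEq I] (F : I → I → A)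
    (h : ∀ i j k l, F k l * F i j - F i j * F k l =
      (if l = i then F k j else 0) - (if j = k then F i l else 0))
    (s : Finset I) {i j : I} (hij : i ∈ s ↔ j ∈ s) : Commute (∑ a ∈ s, F a a) (F i j) := by
  rw [commute_iff_eq, ← sub_eq_zero, Finset.sum_mul, Finset.mul_sum, ← Finset.sum_sub_distrib]
  simp only [h, Finset.sum_sub_distrib, Finset.sum_ite_eq, Finset.sum_ite_eq', hij, sub_self]

lemma Matrix.eq_of_commute_diagonal {V : Type*} [Fintype V] [DecidableEq V] {f : V → ℚ}
    {A : Matrix V V ℚ} (h : Commute (Matrix.diagonal f) A) (v v' : V) (hA : A v v' ≠ 0) :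
    f v = f v' := by
  have := congrFun (congrFun h.eq v) v'
  rw [Matrix.diagonal_mul, Matrix.mul_diagonal, mul_comm] at this
  exact mul_left_cancel₀ hA this

lemma sandwich_mul_sandwich {A : Type*} [Ring A] {P G : A} (hP : P * P = P) (hG : Commute P G)
    (H : A) : P * H * P * (P * G * P) = P * (H * G) * P ∧
      P * G * P * (P * H * P) = P * (G * H) * P := by
  have h : P * G * P = G * P := by rw [hG.eq, mul_assoc, hP]
  constructor
  · rw [h, ← mul_assoc, mul_assoc _ P G, hG.eq]
    simp only [mul_assoc, hP]
  · rw [h, mul_assoc G, ← mul_assoc P, ← mul_assoc P, hP, ← mul_assoc P G, hG.eq]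
    simp only [mul_assoc]

lemma Finset.card_toLeft_eq {α β : Type*} [DecidableEq α] [DecidableEq β] [Fintype α]
    (S : Finset (α ⊕ β)) :
    S.toLeft.card = (S ∩ Finset.univ.map Function.Embedding.inl).card := by
  rw [← Finset.card_map Function.Embedding.inl]
  congr 1
  ext (x | x) <;> simp

lemma Finset.card_toRight_eq {α β : Type*} [DecidableEq α] [DecidableEq β] [Fintype β]
    (S : Finset (α ⊕ β)) :
    S.toRight.card = (S ∩ Finset.univ.map Function.Embedding.inr).card := by
  rw [← Finset.card_map Function.Embedding.inr]
  congr 1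
  ext (x | x) <;> simp

lemma esymmTwoAlphabet_eq (n m j k p : ℕ) : esymmTwoAlphabet n m j k p =
    ∑ F ∈ (Finset.univ : Finset (Finset (Fin n ⊕ Fin m))).powersetCard p, ∏ S ∈ F,
      ∑ i, C (if (S.toLeft.card = j ∧ S.toRight.card = k) ∧ i ∈ S then 1 else 0) * X i := by
  have hL : ∀ S : Finset (Fin n ⊕ Fin m),
      (∑ i, C (if (S.toLeft.card = j ∧ S.toRight.card = k) ∧ i ∈ S then (1 : ℚ) else 0) * X i) =
        if S.toLeft.card = j ∧ S.toRight.card = k then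
          (∑ i ∈ S.toLeft, X (Sum.inl i)) + ∑ i ∈ S.toRight, X (Sum.inr i) else 0 := by
    intro S
    split_ifs with h
    · rw [← Finset.sum_disjSum, Finset.toLeft_disjSum_toRight]
      simp [h, ite_mul, Finset.sum_ite_mem]
    · simp [h]
  simp only [hL]
  set G := (((Finset.univ : Finset (Fin n)).powersetCard j) ×ˢ
    ((Finset.univ : Finset (Fin m)).powersetCard k)).map
      (Finset.sumEquiv (α := Fin n) (β := Fin m)).symm.toEquiv.toEmbedding with hG
  have hmem : ∀ S, S ∈ G ↔ S.toLeft.card = j ∧ S.toRight.card = k := by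
    intro S
    simp only [hG, Finset.mem_map_equiv, Finset.mem_product, Finset.mem_powersetCard]
    simp [Finset.sumEquiv]
  rw [← Finset.sum_subset (Finset.powersetCard_mono (Finset.subset_univ G)), hG,
    Finset.powersetCard_map, Finset.sum_map, esymmTwoAlphabet]
  · refine Finset.sum_congr rfl fun F hF => ?_
    rw [RelEmbedding.coe_toEmbedding, Finset.mapEmbedding_apply, Finset.prod_map]
    refine Finset.prod_congr rfl fun ST hST => ?_
    have h := Finset.mem_product.1 ((Finset.mem_powersetCard.1 hF).1 hST)
    rw [Finset.mem_powersetCard, Finset.mem_powersetCard] at h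
    simp [Finset.sumEquiv, h]
  · intro F hF hFG
    rw [Finset.mem_powersetCard] at hF hFG
    obtain ⟨S, hS, hSG⟩ := Finset.not_subset.1 fun h => hFG ⟨h, hF.2⟩
    exact Finset.prod_eq_zero hS (if_neg fun h => hSG ((hmem S).2 h))

theorem coeff_alternant_mul_esymmTwoAlphabet_nonneg (n m j k p : ℕ) (lam : Fin n ⊕ Fin m →₀ ℕ)
    (hlam : StrictAnti (addStair lam)) :
    0 ≤ coeff (addStair lam) (alternant (stair n m) * esymmTwoAlphabet n m j k p) := by
  obtain ⟨c, hcc, hcd, hnum⟩ := exists_annihilators (Fin n ⊕ Fin m)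
  set F : Fin n ⊕ Fin m → Fin n ⊕ Fin m → Matrix _ _ ℚ := fun i j => (c i).transpose * c j with hF
  have hFc := bilinear_comm c (fun i => (c i).transpose) hcc
    (fun i j => by
      simpa [Matrix.transpose_mul, add_comm] using congrArg Matrix.transpose (hcc i j)) hcd
  set P : Matrix (Finset (Fin n ⊕ Fin m)) (Finset (Fin n ⊕ Fin m)) ℚ :=
    Matrix.diagonal fun S => if S.toLeft.card = j ∧ S.toRight.card = k then 1 else 0 with hP
  have hPP : P * P = P := by
    rw [hP, Matrix.diagonal_mul_diagonal]
    congr 1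
    ext S
    split_ifs <;> simp
  have hPt : P.transpose = P := Matrix.diagonal_transpose _
  have hcard : ∀ (s : Finset (Fin n ⊕ Fin m)) (i j : Fin n ⊕ Fin m), (i ∈ s ↔ j ∈ s) →
      ∀ S T, F i j S T ≠ 0 → (S ∩ s).card = (T ∩ s).card := by
    intro s i j hij S T hST
    have h := bilinear_commute_sum F hFc s hij
    have hs : ∑ a ∈ s, F a a = Matrix.diagonal fun S => ((S ∩ s).card : ℚ) := by
      simp only [hF, hnum]
      ext S T
      rw [Matrix.sum_apply, Matrix.diagonal_apply]
      simp only [Matrix.diagonal_apply]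
      split_ifs with h
      · simp [Finset.inter_comm]
      · simp
    rw [hs] at h
    exact_mod_cast Matrix.eq_of_commute_diagonal h S T hST
  have hPF : ∀ i j : Fin n ⊕ Fin m, i.isLeft = j.isLeft → P * F i j = F i j * P := by
    intro i j hij
    ext S T
    rw [hP, Matrix.diagonal_mul, Matrix.mul_diagonal, mul_comm]
    by_cases h0 : F i j S T = 0
    · rw [h0, zero_mul, zero_mul]
    · rw [Finset.card_toLeft_eq, Finset.card_toRight_eq, Finset.card_toLeft_eq,
        Finset.card_toRight_eq, hcard _ i j _ S T h0, hcard _ i j _ S T h0]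
      all_goals rcases i with i | i <;> rcases j with j | j <;> simp at hij ⊢
  have key := coeff_alternant_mul_esymm_nonneg (fun i => c i * P)
    (fun i S => if (S.toLeft.card = j ∧ S.toRight.card = k) ∧ i ∈ S then 1 else 0) ?_ ?_ p lam hlam
  · rwa [esymmTwoAlphabet_eq]
  · intro i
    rw [Matrix.transpose_mul, hPt, mul_assoc, ← mul_assoc _ (c i), hnum, hP,
      Matrix.diagonal_mul_diagonal, Matrix.diagonal_mul_diagonal]
    congr 1
    ext S
    by_cases h1 : S.toLeft.card = j ∧ S.toRight.card = k
    · rw [if_pos h1, one_mul, mul_one]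
      exact if_congr (by rw [and_iff_right h1]) rfl rfl
    · rw [if_neg h1, zero_mul, if_neg fun h => h1 h.1]
  · intro i j k l hij
    have hρ : ∀ i j, (c i * P).transpose * (c j * P) = P * F i j * P := by
      intro i j
      rw [Matrix.transpose_mul, hPt]
      simp only [hF, mul_assoc]
    obtain ⟨e1, e2⟩ := sandwich_mul_sandwich hPP (hPF i j hij) (F k l)
    rw [hρ, hρ, hρ, hρ, e1, e2, ← sub_mul, ← mul_sub, hFc, mul_sub, sub_mul]
    congr 1 <;> split_ifs <;> first | rfl | rw [mul_zero, zero_mul]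

section Bialternant

lemma hsymm_eq_coeff_prod (σ R : Type*) [Fintype σ] [DecidableEq σ] [CommRing R] (q : ℕ) :
    hsymm σ R q = PowerSeries.coeff q
      (∏ l : σ, PowerSeries.mk fun d => (X l : MvPolynomial σ R) ^ d) := by
  rw [PowerSeries.coeff_prod, hsymm]
  refine Finset.sum_bij (fun s _ => Multiset.toFinsupp s.1) ?_ ?_ ?_ ?_
  · intro s _
    refine Finset.mem_finsuppAntidiag.2 ⟨?_, Finset.subset_univ _⟩
    calc ∑ i, Multiset.toFinsupp s.1 i = ∑ i, s.1.count i := rfl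
      _ = q := by rw [Multiset.sum_count_eq_card fun _ _ => Finset.mem_univ _, s.2]
  · intro s _ t _ h
    exact Subtype.ext (Multiset.toFinsupp.injective h)
  · intro f hf
    obtain ⟨hf, -⟩ := Finset.mem_finsuppAntidiag.1 hf
    refine ⟨⟨Finsupp.toMultiset f, ?_⟩, Finset.mem_univ _, by simp⟩
    rw [Finsupp.card_toMultiset, Finsupp.sum_fintype _ _ (fun _ => rfl)]
    exact hf
  · intro s _
    rw [Finset.prod_multiset_map_count]
    refine (Finset.prod_subset (Finset.subset_univ _) fun i _ hi => ?_).trans ?_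
    · rw [Multiset.count_eq_zero_of_notMem fun h => hi (Multiset.mem_toFinset.2 h), pow_zero]
    · simp [Multiset.toFinsupp_apply]

lemma mk_pow_mul_one_sub {R : Type*} [CommRing R] (r : R) :
    (PowerSeries.mk fun d => r ^ d) * (1 - PowerSeries.C r * PowerSeries.X) = 1 := by
  ext d
  rw [mul_sub, mul_one, ← mul_assoc, map_sub]
  rcases d with _ | d
  · simp
  · rw [PowerSeries.coeff_succ_mul_X, PowerSeries.coeff_mul_C]
    simp [pow_succ, PowerSeries.coeff_one]

/-- The generating polynomial of the signed elementary symmetric polynomials in all variables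
but the `k`-th. -/
noncomputable def omitGen {n : ℕ} (k : Fin n) : Polynomial (MvPolynomial (Fin n) ℚ) :=
  ∏ l ∈ Finset.univ.erase k, (1 - Polynomial.C (X l) * Polynomial.X)

lemma natDegree_omitGen_lt {n : ℕ} (k : Fin n) : (omitGen k).natDegree < n := by
  have h : (omitGen k).natDegree ≤ ∑ _l ∈ Finset.univ.erase k, 1 := by
    refine (Polynomial.natDegree_prod_le _ _).trans (Finset.sum_le_sum fun l _ => ?_)
    compute_degree
  rw [Finset.sum_const, Finset.card_erase_of_mem (Finset.mem_univ k), Finset.card_univ,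
    Fintype.card_fin, smul_eq_mul, mul_one] at h
  have := k.2
  omega

lemma mk_hsymm_mul_omitGen {n : ℕ} (k : Fin n) :
    (PowerSeries.mk fun q => hsymm (Fin n) ℚ q) * (omitGen k : PowerSeries (MvPolynomial (Fin n) ℚ)) =
      PowerSeries.mk fun q => X k ^ q := by
  have h : (PowerSeries.mk fun q => hsymm (Fin n) ℚ q) =
      ∏ l : Fin n, PowerSeries.mk fun d => (X l : MvPolynomial (Fin n) ℚ) ^ d := by
    ext1 q
    rw [PowerSeries.coeff_mk, hsymm_eq_coeff_prod]
  have h' : (omitGen k : PowerSeries (MvPolynomial (Fin n) ℚ)) =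
      ∏ l ∈ Finset.univ.erase k, (1 - PowerSeries.C (X l) * PowerSeries.X) := by
    rw [omitGen, ← Polynomial.coeToPowerSeries.ringHom_apply, map_prod]
    simp
  rw [h, h', ← Finset.mul_prod_erase _ _ (Finset.mem_univ k), mul_assoc,
    ← Finset.prod_mul_distrib, Finset.prod_congr rfl fun l _ => mk_pow_mul_one_sub _,
    Finset.prod_const_one, mul_one]

lemma sum_hInt_mul_coeff_omitGen {n : ℕ} (k : Fin n) (q : ℕ) :
    ∑ r ∈ Finset.range n, hInt n ((q : ℤ) - r) * (omitGen k).coeff r = X k ^ q := by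
  have h := congrArg (PowerSeries.coeff q) (mk_hsymm_mul_omitGen k)
  rw [PowerSeries.coeff_mk, mul_comm, PowerSeries.coeff_mul,
    Finset.Nat.sum_antidiagonal_eq_sum_range_succ_mk] at h
  rw [← h]
  have h1 : ∑ r ∈ Finset.range n, hInt n ((q : ℤ) - r) * (omitGen k).coeff r =
      ∑ r ∈ Finset.range (n + (q + 1)), hInt n ((q : ℤ) - r) * (omitGen k).coeff r := by
    refine Finset.sum_subset (Finset.range_mono (by omega)) fun r _ hr => ?_
    rw [Polynomial.coeff_eq_zero_of_natDegree_lt, mul_zero]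
    exact (natDegree_omitGen_lt k).trans_le (by simpa using hr)
  rw [h1, ← Finset.sum_subset (s₁ := Finset.range (q + 1)) (Finset.range_mono (by omega))]
  · refine Finset.sum_congr rfl fun r hr => ?_
    have hr : r ≤ q := Nat.lt_succ_iff.1 (Finset.mem_range.1 hr)
    rw [hInt, if_pos (by omega), Polynomial.coeff_coe, PowerSeries.coeff_mk, mul_comm]
    congr 2
    omega
  · intro r _ hr
    rw [hInt, if_neg, zero_mul]
    have : ¬ r < q + 1 := by simpa using hr
    omega

lemma jacobiTrudi_mul_omitGen {n : ℕ} (lam : Fin n → ℕ) :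
    (Matrix.of fun i j : Fin n => hInt n ((lam i : ℤ) - (i : ℤ) + (j : ℤ))) *
      (Matrix.of fun j k : Fin n => (omitGen k).coeff (n - 1 - (j : ℕ))) =
    Matrix.of fun i k : Fin n => (X k : MvPolynomial (Fin n) ℚ) ^ (lam i + (n - 1 - (i : ℕ))) := by
  ext1 i k
  rw [Matrix.mul_apply, Matrix.of_apply, ← sum_hInt_mul_coeff_omitGen, Finset.sum_range,
    ← Equiv.sum_comp Fin.revPerm]
  refine Finset.sum_congr rfl fun r _ => ?_
  have hi := i.2
  have hr := r.2
  simp only [Matrix.of_apply, Fin.revPerm_apply, Fin.val_rev]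
  congr 2 <;> omega

theorem schur_mul_det {n : ℕ} (lam : Fin n → ℕ) :
    schur n lam * (Matrix.of fun i k : Fin n =>
        (X k : MvPolynomial (Fin n) ℚ) ^ (n - 1 - (i : ℕ))).det =
      (Matrix.of fun i k : Fin n =>
        (X k : MvPolynomial (Fin n) ℚ) ^ (lam i + (n - 1 - (i : ℕ)))).det := by
  have h0 : schur n 0 = 1 := by
    rw [schur, Matrix.det_of_isUpperTriangular]
    · refine Finset.prod_eq_one fun i _ => ?_
      simp [hInt]
    · intro i j hij
      have : (j : ℕ) < i := hij
      rw [Matrix.of_apply, hInt, if_neg]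
      simp only [Pi.zero_apply]
      omega
  have h1 := congrArg Matrix.det (jacobiTrudi_mul_omitGen (0 : Fin n → ℕ))
  rw [Matrix.det_mul, ← schur, h0, one_mul] at h1
  simp only [Pi.zero_apply, zero_add] at h1
  rw [← h1, ← jacobiTrudi_mul_omitGen, Matrix.det_mul, schur]

end Bialternant

lemma alternant_add_stair {n m : ℕ} (κ : Fin n → ℕ) (μ : Fin m → ℕ) :
    alternant (fun i => Sum.elim κ μ i + stair n m i) =
      alternant (stair n m) * (schurX n m κ * schurY n m μ) := by
  rw [alternant_eq_det_mul_det, alternant_eq_det_mul_det, schurX, schurY]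
  simp only [Sum.elim_inl, Sum.elim_inr, stair]
  rw [← schur_mul_det, ← schur_mul_det, map_mul, map_mul]
  ring

lemma coeff_rename_perm {I : Type*} [Fintype I] (e : Equiv.Perm I) (g : MvPolynomial I ℚ)
    (κ : I → ℕ) : coeff (Finsupp.equivFunOnFinite.symm κ) (rename e g) =
      coeff (Finsupp.equivFunOnFinite.symm (κ ∘ e)) g := by
  have h : (Finsupp.equivFunOnFinite.symm (κ ∘ e)).mapDomain e =
      Finsupp.equivFunOnFinite.symm κ := by
    ext i
    obtain ⟨i, rfl⟩ := e.surjective i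
    rw [Finsupp.mapDomain_apply e.injective]
    rfl
  rw [← h, coeff_rename_mapDomain e e.injective]

/-- Antisymmetry under permutations of the `x`-alphabet and of the `y`-alphabet. -/
def BlockAntisymm {n m : ℕ} (g : MvPolynomial (Fin n ⊕ Fin m) ℚ) : Prop :=
  ∀ w : Equiv.Perm (Fin n) × Equiv.Perm (Fin m), rename (Equiv.sumCongr w.1 w.2) g =
    C (((Equiv.Perm.sign w.1 : ℤ) : ℚ) * ((Equiv.Perm.sign w.2 : ℤ) : ℚ)) * g

namespace BlockAntisymm

variable {n m : ℕ} {g h : MvPolynomial (Fin n ⊕ Fin m) ℚ}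

lemma sub (hg : BlockAntisymm g) (hh : BlockAntisymm h) : BlockAntisymm (g - h) := fun w => by
  rw [map_sub, hg w, hh w, mul_sub]

lemma C_mul (hg : BlockAntisymm g) (r : ℚ) : BlockAntisymm (C r * g) := fun w => by
  rw [map_mul, hg w, rename_C]
  ring

lemma sum {ι : Type*} {s : Finset ι} {f : ι → MvPolynomial (Fin n ⊕ Fin m) ℚ}
    (hf : ∀ i ∈ s, BlockAntisymm (f i)) : BlockAntisymm (∑ i ∈ s, f i) := fun w => by
  rw [map_sum, Finset.mul_sum]
  exact Finset.sum_congr rfl fun i hi => hf i hi w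

lemma mul_of_symm (hg : BlockAntisymm g) (hh : ∀ w : Equiv.Perm (Fin n) × Equiv.Perm (Fin m),
    rename (Equiv.sumCongr w.1 w.2) h = h) : BlockAntisymm (g * h) := fun w => by
  rw [map_mul, hg w, hh w, mul_assoc]

lemma coeff_comp (hg : BlockAntisymm g) (w : Equiv.Perm (Fin n) × Equiv.Perm (Fin m))
    (κ : Fin n ⊕ Fin m → ℕ) :
    coeff (Finsupp.equivFunOnFinite.symm (κ ∘ Equiv.sumCongr w.1 w.2)) g =
      ((Equiv.Perm.sign w.1 : ℤ) : ℚ) * ((Equiv.Perm.sign w.2 : ℤ) : ℚ) *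
        coeff (Finsupp.equivFunOnFinite.symm κ) g := by
  rw [← coeff_rename_perm, hg w, coeff_C_mul]

lemma coeff_eq_zero (hg : BlockAntisymm g) {κ : Fin n ⊕ Fin m → ℕ}
    {i j : Fin n ⊕ Fin m} (hij : i < j) (h : κ i = κ j) :
    coeff (Finsupp.equivFunOnFinite.symm κ) g = 0 := by
  have key : ∀ w : Equiv.Perm (Fin n) × Equiv.Perm (Fin m), κ ∘ Equiv.sumCongr w.1 w.2 = κ →
      ((Equiv.Perm.sign w.1 : ℤ) : ℚ) * ((Equiv.Perm.sign w.2 : ℤ) : ℚ) = -1 →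
      coeff (Finsupp.equivFunOnFinite.symm κ) g = 0 := by
    intro w hw hs
    have := hg.coeff_comp w κ
    rw [hw, hs] at this
    linarith
  rcases i with i | i <;> rcases j with j | j
  · refine key (Equiv.swap i j, 1) ?_ ?_
    · ext (x | x)
      · simp only [Function.comp_apply, Equiv.sumCongr_apply, Sum.map_inl, Equiv.swap_apply_def]
        split_ifs with h1 h2
        · rw [h1, h]
        · rw [h2, h]
        · rfl
      · rfl
    · rw [Sum.inl_lt_inl_iff] at hij
      simp [Equiv.Perm.sign_swap hij.ne]
  · exact absurd hij Sum.not_inl_lt_inr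
  · exact absurd hij Sum.not_inr_lt_inl
  · refine key (1, Equiv.swap i j) ?_ ?_
    · ext (x | x)
      · rfl
      · simp only [Function.comp_apply, Equiv.sumCongr_apply, Sum.map_inr, Equiv.swap_apply_def]
        split_ifs with h1 h2
        · rw [h1, h]
        · rw [h2, h]
        · rfl
    · rw [Sum.inr_lt_inr_iff] at hij
      simp [Equiv.Perm.sign_swap hij.ne]

lemma exists_antitone_comp {k : ℕ} (f : Fin k → ℕ) : ∃ σ : Equiv.Perm (Fin k), Antitone (f ∘ σ) :=
  ⟨Tuple.sort (OrderDual.toDual ∘ f), fun _ _ h => Tuple.monotone_sort (OrderDual.toDual ∘ f) h⟩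

lemma eq_zero (hg : BlockAntisymm g) (h : ∀ κ : Fin n ⊕ Fin m → ℕ, StrictAnti κ →
    coeff (Finsupp.equivFunOnFinite.symm κ) g = 0) : g = 0 := by
  ext d
  obtain ⟨κ, rfl⟩ := Finsupp.equivFunOnFinite.symm.surjective d
  obtain ⟨σ, hσ⟩ := exists_antitone_comp (κ ∘ Sum.inl)
  obtain ⟨τ, hτ⟩ := exists_antitone_comp (κ ∘ Sum.inr)
  have h0 : coeff (Finsupp.equivFunOnFinite.symm (κ ∘ Equiv.sumCongr σ τ)) g = 0 := by
    by_cases hs : StrictAnti (κ ∘ Equiv.sumCongr σ τ)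
    · exact h _ hs
    · have hex : ∃ i j, i < j ∧ ¬ (κ ∘ Equiv.sumCongr σ τ) j < (κ ∘ Equiv.sumCongr σ τ) i := by
        by_contra! hc
        exact hs fun i j hij => hc i j hij
      obtain ⟨i, j, hij, hlt⟩ := hex
      refine hg.coeff_eq_zero hij (le_antisymm (not_lt.1 hlt) ?_)
      rcases i with i | i <;> rcases j with j | j
      · exact hσ (Sum.inl_lt_inl_iff.1 hij).le
      · exact absurd hij Sum.not_inl_lt_inr
      · exact absurd hij Sum.not_inr_lt_inl
      · exact hτ (Sum.inr_lt_inr_iff.1 hij).le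
  rw [hg.coeff_comp (σ, τ)] at h0
  rw [coeff_zero]
  rcases mul_eq_zero.1 h0 with h1 | h1
  · rcases Int.units_eq_one_or (Equiv.Perm.sign σ) with h2 | h2 <;>
      rcases Int.units_eq_one_or (Equiv.Perm.sign τ) with h3 | h3 <;> simp [h2, h3] at h1
  · exact h1

end BlockAntisymm

lemma blockAntisymm_alternant {n m : ℕ} (κ : Fin n ⊕ Fin m → ℕ) : BlockAntisymm (alternant κ) := by
  intro v
  rw [alternant, map_sum, Finset.mul_sum, ← Equiv.sum_comp (Equiv.mulRight v)]
  refine Finset.sum_congr rfl fun w _ => ?_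
  rw [rename_monomial, C_mul_monomial]
  refine congrArg₂ (fun d r => monomial d r) ?_ ?_
  · refine Finsupp.ext fun i => ?_
    obtain ⟨i, rfl⟩ := (Equiv.sumCongr v.1 v.2).surjective i
    rw [Finsupp.mapDomain_apply (Equiv.injective _)]
    rcases i with i | i <;> simp
  · simp only [Equiv.coe_mulRight, Prod.fst_mul, Prod.snd_mul, Equiv.Perm.sign_mul, Units.val_mul,
      Int.cast_mul]
    ring

lemma Equiv.Perm.eq_one_of_strictAnti {k : ℕ} {f f' : Fin k → ℕ} (hf : StrictAnti f)
    (hf' : StrictAnti f') (w : Equiv.Perm (Fin k)) (h : f ∘ w = f') : w = 1 := by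
  have hw : StrictMono w := by
    intro a b hab
    have := hf' hab
    rw [← h] at this
    exact hf.lt_iff_gt.1 this
  ext1 a
  exact congrFun ((hw.range_inj strictMono_id).1 (by simp)) a

lemma coeff_alternant {n m : ℕ} {κ κ' : Fin n ⊕ Fin m → ℕ} (hκ : StrictAnti κ)
    (hκ' : StrictAnti κ') : coeff (Finsupp.equivFunOnFinite.symm κ') (alternant κ) =
      if κ = κ' then 1 else 0 := by
  have hw : ∀ w : Equiv.Perm (Fin n) × Equiv.Perm (Fin m),
      κ ∘ Equiv.sumCongr w.1 w.2 = κ' → w = 1 := by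
    rintro ⟨σ, τ⟩ hw
    refine Prod.ext ?_ ?_
    · refine Equiv.Perm.eq_one_of_strictAnti (hκ.comp_strictMono Sum.inl_strictMono)
        (hκ'.comp_strictMono Sum.inl_strictMono) σ ?_
      rw [← hw]; rfl
    · refine Equiv.Perm.eq_one_of_strictAnti (hκ.comp_strictMono Sum.inr_strictMono)
        (hκ'.comp_strictMono Sum.inr_strictMono) τ ?_
      rw [← hw]; rfl
  have h1 : κ ∘ Equiv.sumCongr (1 : Equiv.Perm (Fin n)) (1 : Equiv.Perm (Fin m)) = κ := by
    ext (i | i) <;> rfl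
  rw [alternant, coeff_sum, Finset.sum_eq_single 1]
  · rw [coeff_monomial, Prod.fst_one, Prod.snd_one, h1]
    simp
  · intro w _ hne
    rw [coeff_monomial, if_neg]
    exact fun h => hne (hw w (Finsupp.equivFunOnFinite.symm.injective h))
  · simp

lemma rename_esymmTwoAlphabet (n m j k p : ℕ) (w : Equiv.Perm (Fin n) × Equiv.Perm (Fin m)) :
    rename (Equiv.sumCongr w.1 w.2) (esymmTwoAlphabet n m j k p) = esymmTwoAlphabet n m j k p := by
  set e : Finset (Fin n) × Finset (Fin m) ≃ Finset (Fin n) × Finset (Fin m) :=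
    w.1.finsetCongr.prodCongr w.2.finsetCongr with he
  have hG : (((Finset.univ : Finset (Fin n)).powersetCard j) ×ˢ
      ((Finset.univ : Finset (Fin m)).powersetCard k)).map e.toEmbedding =
      ((Finset.univ : Finset (Fin n)).powersetCard j) ×ˢ
        ((Finset.univ : Finset (Fin m)).powersetCard k) := by
    ext ST
    simp [he, Finset.mem_map_equiv, Finset.mem_powersetCard]
  conv_rhs => rw [esymmTwoAlphabet, ← hG, Finset.powersetCard_map, Finset.sum_map]
  rw [esymmTwoAlphabet, map_sum]
  refine Finset.sum_congr rfl fun F _ => ?_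
  rw [map_prod, RelEmbedding.coe_toEmbedding, Finset.mapEmbedding_apply, Finset.prod_map]
  refine Finset.prod_congr rfl fun ST _ => ?_
  simp [he]

lemma alternant_stair_ne_zero (n m : ℕ) : alternant (stair n m) ≠ 0 := by
  rw [alternant_stair]
  exact Finset.prod_ne_zero_iff.2 fun q hq =>
    sub_ne_zero.2 fun h => (mem_posPairs.1 hq).ne (X_injective h)

lemma exists_intCast_coeff_alternant_mul (n m j k p : ℕ) (d : Fin n ⊕ Fin m →₀ ℕ) :
    ∃ z : ℤ, coeff d (alternant (stair n m) * esymmTwoAlphabet n m j k p) = z := by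
  have hX : ∀ i, X i ∈ (map (σ := Fin n ⊕ Fin m) (Int.castRingHom ℚ)).range :=
    fun i => ⟨X i, map_X _ i⟩
  have h : alternant (stair n m) * esymmTwoAlphabet n m j k p ∈
      (map (σ := Fin n ⊕ Fin m) (Int.castRingHom ℚ)).range := by
    rw [alternant_stair, esymmTwoAlphabet]
    exact mul_mem (prod_mem fun q _ => sub_mem (hX _) (hX _))
      (sum_mem fun F _ => prod_mem fun ST _ =>
        add_mem (sum_mem fun i _ => hX _) (sum_mem fun i _ => hX _))
  obtain ⟨g, hg⟩ := h
  exact ⟨coeff d g, by rw [← hg, coeff_map]; rfl⟩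

lemma StrictAnti.antitone_sub_rev {k : ℕ} {κ : Fin k → ℕ} (hκ : StrictAnti κ) :
    (∀ i : Fin k, k - 1 - (i : ℕ) ≤ κ i) ∧ Antitone fun i : Fin k => κ i - (k - 1 - (i : ℕ)) := by
  have hstep : ∀ d : ℕ, ∀ i j : Fin k, (j : ℕ) = i + d → κ j + d ≤ κ i := by
    intro d
    induction d with
    | zero =>
      intro i j h
      rw [Fin.ext h]
      rfl
    | succ d ih =>
      intro i j h
      have hj := j.2
      have h1 := ih i ⟨i + d, by omega⟩ rfl
      have h2 : κ j < κ ⟨i + d, by omega⟩ := hκ (Fin.lt_def.2 (by simp only []; omega))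
      omega
  constructor
  · intro i
    have hi := i.2
    have := hstep (k - 1 - i) i ⟨k - 1, by omega⟩ (by simp only []; omega)
    omega
  · intro i j hij
    have hj := j.2
    have hij : (i : ℕ) ≤ j := hij
    have := hstep (j - i) i j (by omega)
    simp only []
    omega

lemma strictAnti_add_stair {n m : ℕ} {κ : Fin n → ℕ} {μ : Fin m → ℕ} (hκ : Antitone κ)
    (hμ : Antitone μ) : StrictAnti fun i => Sum.elim κ μ i + stair n m i := by
  intro a b hab
  rcases a with a | a <;> rcases b with b | b
  · exact add_lt_add_of_le_of_lt (hκ (Sum.inl_lt_inl_iff.1 hab).le)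
      (stair_strictAnti n (Sum.inl_lt_inl_iff.1 hab))
  · exact absurd hab Sum.not_inl_lt_inr
  · exact absurd hab Sum.not_inr_lt_inl
  · exact add_lt_add_of_le_of_lt (hμ (Sum.inr_lt_inr_iff.1 hab).le)
      (stair_strictAnti m (Sum.inr_lt_inr_iff.1 hab))

lemma exists_eq_add_stair {n m : ℕ} {κ : Fin n ⊕ Fin m → ℕ} (hκ : StrictAnti κ) :
    ∃ (ν : Fin n → ℕ) (μ : Fin m → ℕ), Antitone ν ∧ Antitone μ ∧
      κ = fun i => Sum.elim ν μ i + stair n m i := by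
  obtain ⟨h1, h2⟩ := (hκ.comp_strictMono Sum.inl_strictMono).antitone_sub_rev
  obtain ⟨h3, h4⟩ := (hκ.comp_strictMono Sum.inr_strictMono).antitone_sub_rev
  refine ⟨_, _, h2, h4, ?_⟩
  ext (i | i)
  · exact (Nat.sub_add_cancel (h1 i)).symm
  · exact (Nat.sub_add_cancel (h3 i)).symm

/-- Expansion of a block-antisymmetric polynomial in alternants. -/
lemma BlockAntisymm.exists_eq_sum {n m : ℕ} {g : MvPolynomial (Fin n ⊕ Fin m) ℚ}
    (hg : BlockAntisymm g) : ∃ Q : Finset ((Fin n → ℕ) × (Fin m → ℕ)),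
      (∀ q ∈ Q, Antitone q.1 ∧ Antitone q.2) ∧
      g = ∑ q ∈ Q, C (coeff (Finsupp.equivFunOnFinite.symm
        fun i => Sum.elim q.1 q.2 i + stair n m i) g) *
          alternant fun i => Sum.elim q.1 q.2 i + stair n m i := by
  classical
  have hinj : Set.InjOn (fun q : (Fin n → ℕ) × (Fin m → ℕ) =>
      (Finsupp.equivFunOnFinite.symm fun i => Sum.elim q.1 q.2 i + stair n m i))
      Set.univ := by
    rintro ⟨a, b⟩ - ⟨a', b'⟩ - h
    have h := Finsupp.equivFunOnFinite.symm.injective h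
    refine Prod.ext (funext fun i => ?_) (funext fun i => ?_)
    · simpa using congrFun h (Sum.inl i)
    · simpa using congrFun h (Sum.inr i)
  set Q := (g.support.preimage _ (hinj.mono (Set.subset_univ _))).filter
    fun q => Antitone q.1 ∧ Antitone q.2 with hQ
  have hQa : ∀ q ∈ Q, Antitone q.1 ∧ Antitone q.2 := fun q hq => (Finset.mem_filter.1 hq).2
  refine ⟨Q, hQa, sub_eq_zero.1 ?_⟩
  refine BlockAntisymm.eq_zero
    (hg.sub (.sum fun q _ => (blockAntisymm_alternant _).C_mul _)) fun κ hκ => ?_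
  obtain ⟨ν, μ, hν, hμ, rfl⟩ := exists_eq_add_stair hκ
  rw [coeff_sub, coeff_sum, sub_eq_zero]
  have h : ∀ q ∈ Q, coeff (Finsupp.equivFunOnFinite.symm fun i => Sum.elim ν μ i + stair n m i)
      (C (coeff (Finsupp.equivFunOnFinite.symm fun i => Sum.elim q.1 q.2 i + stair n m i) g) *
        alternant fun i => Sum.elim q.1 q.2 i + stair n m i) =
      if q = (ν, μ) then coeff (Finsupp.equivFunOnFinite.symm
        fun i => Sum.elim ν μ i + stair n m i) g else 0 := by
    intro q hq
    rw [coeff_C_mul, coeff_alternant (strictAnti_add_stair (hQa q hq).1 (hQa q hq).2) hκ, mul_ite,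
      mul_one, mul_zero]
    by_cases h : q = (ν, μ)
    · subst h
      simp
    · rw [if_neg h, if_neg]
      exact fun h' => h (hinj (Set.mem_univ _) (Set.mem_univ _)
        (congrArg Finsupp.equivFunOnFinite.symm h'))
  rw [Finset.sum_congr rfl h, Finset.sum_ite_eq']
  split_ifs with hq
  · rfl
  · by_contra h0
    exact hq (Finset.mem_filter.2 ⟨Finset.mem_preimage.2 (mem_support_iff.2 h0), hν, hμ⟩)

theorem stmt13 (n m j k p : ℕ) (hj : 1 ≤ j) (hjn : j ≤ n) (hk : 1 ≤ k) (hkm : k ≤ m)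
    (hp : p ≤ n.choose j * m.choose k) :
    ∃ (Q : Finset ((Fin n → ℕ) × (Fin m → ℕ)))
      (a : (Fin n → ℕ) × (Fin m → ℕ) → ℕ),
      (∀ lm ∈ Q, Antitone lm.1 ∧ Antitone lm.2) ∧
      esymmTwoAlphabet n m j k p = ∑ lm ∈ Q,
        (a lm : MvPolynomial (Fin n ⊕ Fin m) ℚ) * schurX n m lm.1 * schurY n m lm.2 := by
  obtain ⟨Q, hQ, hsum⟩ := ((blockAntisymm_alternant (stair n m)).mul_of_symm
    (rename_esymmTwoAlphabet n m j k p)).exists_eq_sum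
  choose z hz using exists_intCast_coeff_alternant_mul n m j k p
  refine ⟨Q, fun lm => (z (Finsupp.equivFunOnFinite.symm
    fun i => Sum.elim lm.1 lm.2 i + stair n m i)).toNat, hQ,
    mul_left_cancel₀ (alternant_stair_ne_zero n m) ?_⟩
  rw [hsum, Finset.mul_sum]
  refine Finset.sum_congr rfl fun lm hlm => ?_
  have hnonneg := coeff_alternant_mul_esymmTwoAlphabet_nonneg n m j k p
    (Finsupp.equivFunOnFinite.symm (Sum.elim lm.1 lm.2))
    (strictAnti_add_stair (hQ lm hlm).1 (hQ lm hlm).2)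
  have hadd : addStair (Finsupp.equivFunOnFinite.symm (Sum.elim lm.1 lm.2)) =
      Finsupp.equivFunOnFinite.symm fun i => Sum.elim lm.1 lm.2 i + stair n m i := by
    ext i
    rfl
  rw [hadd, hz, Int.cast_nonneg_iff] at hnonneg
  rw [hz, alternant_add_stair]
  obtain ⟨a, ha⟩ := Int.eq_ofNat_of_zero_le hnonneg
  simp only [ha, Int.toNat_natCast, Int.cast_natCast, map_natCast]
  ring
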